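/- Let 1 ≤ m ≤ n be integers. The expected value of the entanglement entropy over all pure states, i.e. the integral ∫_{S^{2mn−1}} E(v) dμ(v) of the entanglement entropy with respect to the uniform probability measure μ on the unit sphere of ℂ^m ⊗ ℂ^n, equals Σ_{k=n+1}^{mn} 1/k − (m−1)/(2n). -/

import Mathlib

open MeasureTheory Matrix

noncomputable section

instance (ι : Type*) [Fintype ι] : MeasurableSpace (EuclideanSpace ℂ ι) := borel _
instance (ι : Type*) [Fintype ι] : BorelSpace (EuclideanSpace ℂ ι) := ⟨rfl⟩
instance (ι : Type*) [Fintype ι] : InnerProductSpace ℝ (EuclideanSpace ℂ ι) :=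
  InnerProductSpace.rclikeToReal ℂ _

/-- The model for `ℂ^m ⊗ ℂ^n`: a Euclidean space indexed by `Fin m × Fin n`,
so that a vector is identified with the matrix of its coefficients in the
fixed (standard) orthonormal bases. -/
abbrev TensorSp (m n : ℕ) := EuclideanSpace ℂ (Fin m × Fin n)

/-- The coefficient matrix `A(v)` of `v ∈ ℂ^m ⊗ ℂ^n`. -/
def coeffMatrix {m n : ℕ} (v : TensorSp m n) : Matrix (Fin m) (Fin n) ℂ :=
  Matrix.of fun j k => v (j, k)

/-- The reduced density matrix `ρ(v) = A(v) A(v)*`. -/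
def redDensity {m n : ℕ} (v : TensorSp m n) : Matrix (Fin m) (Fin m) ℂ :=
  coeffMatrix v * (coeffMatrix v)ᴴ

theorem redDensity_isHermitian {m n : ℕ} (v : TensorSp m n) :
    (redDensity v).IsHermitian :=
  Matrix.isHermitian_mul_conjTranspose_self _

/-- The eigenvalues `p_1(v), …, p_m(v)` of the reduced density matrix
(the squares of the Schmidt coefficients of `v`). -/
def schmidtSq {m n : ℕ} (v : TensorSp m n) : Fin m → ℝ :=
  (redDensity_isHermitian v).eigenvalues

/-- The entanglement entropy `E(v) = -∑ p_j ln p_j` (recall `Real.log 0 = 0`,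
which implements the convention `0 · ln 0 = 0`). -/
def entEntropy {m n : ℕ} (v : TensorSp m n) : ℝ :=
  -∑ j, schmidtSq v j * Real.log (schmidtSq v j)

/-- The uniform (rotation-invariant) probability measure on the unit sphere
`S^{2mn-1}` of `ℂ^m ⊗ ℂ^n`: the normalization of the measure induced on the
sphere by the Lebesgue (Haar) measure of the ambient Euclidean space. -/
def sphereUniform (m n : ℕ) : Measure (Metric.sphere (0 : TensorSp m n) 1) :=
  ((volume : Measure (TensorSp m n)).toSphere Set.univ)⁻¹ •
    (volume : Measure (TensorSp m n)).toSphere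

/-- The standard complex Gaussian measure, with density `π⁻¹ exp (-‖z‖²)`. -/
def cGauss : Measure ℂ :=
  volume.withDensity fun z => ENNReal.ofReal (Real.pi⁻¹ * Real.exp (-‖z‖ ^ 2))

theorem lintegral_cGauss (s : ℝ) (hs : 0 ≤ s) :
    ∫⁻ z, ENNReal.ofReal (Real.exp (-(s * ‖z‖ ^ 2))) ∂cGauss = ENNReal.ofReal (1 / (1 + s)) := by
  have h1 : (0 : ℝ) < 1 + s := by linarith
  have h2 : ∫ v : ℂ, Real.exp (-(1 + s) * ‖v‖ ^ 2) = Real.pi / (1 + s) := by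
    rw [GaussianFourier.integral_rexp_neg_mul_sq_norm h1]
    simp [Complex.finrank_real_complex]
  have hi : Integrable (fun v : ℂ => Real.exp (-(1 + s) * ‖v‖ ^ 2)) := by
    by_contra h
    rw [integral_undef h] at h2
    have : (0 : ℝ) < Real.pi / (1 + s) := by positivity
    linarith
  rw [cGauss, lintegral_withDensity_eq_lintegral_mul _ (by fun_prop) (by fun_prop)]
  have : ∀ z : ℂ, ((fun z : ℂ => ENNReal.ofReal (Real.pi⁻¹ * Real.exp (-‖z‖ ^ 2))) *
      fun z : ℂ => ENNReal.ofReal (Real.exp (-(s * ‖z‖ ^ 2)))) z =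
      ENNReal.ofReal (Real.pi⁻¹ * Real.exp (-(1 + s) * ‖z‖ ^ 2)) := by
    intro z
    rw [Pi.mul_apply, ← ENNReal.ofReal_mul (by positivity), mul_assoc, ← Real.exp_add]
    ring_nf
  simp_rw [this]
  rw [← ofReal_integral_eq_lintegral_ofReal (hi.const_mul _)
    (Filter.Eventually.of_forall fun z => by positivity), integral_const_mul, h2]
  congr 1
  field_simp

instance : IsProbabilityMeasure cGauss := by
  constructor
  have := lintegral_cGauss 0 le_rfl
  simpa using this

/-- The law of a family of independent standard complex Gaussian variables. -/
def cGaussPi (ι : Type*) [Fintype ι] : Measure (ι → ℂ) := Measure.pi fun _ => cGauss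

instance (ι : Type*) [Fintype ι] : IsProbabilityMeasure (cGaussPi ι) := by
  unfold cGaussPi; infer_instance

theorem cGaussPi_eq_withDensity (ι : Type*) [Fintype ι] :
    cGaussPi ι = volume.withDensity fun x => ENNReal.ofReal
      (∏ i, (Real.pi⁻¹ * Real.exp (-‖x i‖ ^ 2))) := by
  refine Measure.pi_eq (μ := fun _ : ι => cGauss) fun s hs => ?_
  have hint : Integrable (fun z : ℂ => Real.pi⁻¹ * Real.exp (-‖z‖ ^ 2)) := by
    refine ⟨by fun_prop, ?_⟩
    rw [hasFiniteIntegral_iff_ofReal (Filter.Eventually.of_forall fun z => by positivity)]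
    have : cGauss Set.univ < ⊤ := measure_lt_top _ _
    simpa [cGauss] using this
  rw [withDensity_apply _ (MeasurableSet.univ_pi hs), volume_pi,
    Measure.restrict_pi_pi (fun _ : ι => (volume : Measure ℂ)),
    ← ofReal_integral_eq_lintegral_ofReal]
  · rw [integral_fintype_prod_eq_prod (f := fun _ z => Real.pi⁻¹ * Real.exp (-‖z‖ ^ 2)),
      ENNReal.ofReal_prod_of_nonneg fun i _ => integral_nonneg fun z => by positivity]
    refine Finset.prod_congr rfl fun i _ => ?_
    rw [cGauss, withDensity_apply _ (hs i), ofReal_integral_eq_lintegral_ofReal hint.restrict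
      (Filter.Eventually.of_forall fun z => by positivity)]
  · exact Integrable.fintype_prod (f := fun _ z => Real.pi⁻¹ * Real.exp (-‖z‖ ^ 2))
      fun i => hint.restrict
  · exact Filter.Eventually.of_forall fun z => Finset.prod_nonneg fun i _ => by positivity

theorem norm_toLp_sq {ι : Type*} [Fintype ι] (x : ι → ℂ) :
    ‖(WithLp.toLp 2 x : EuclideanSpace ℂ ι)‖ ^ 2 = ∑ i, ‖x i‖ ^ 2 := by
  rw [EuclideanSpace.norm_sq_eq]

theorem measurable_toLp_euclidean {ι : Type*} [Fintype ι] :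
    Measurable (fun x : ι → ℂ => (WithLp.toLp 2 x : EuclideanSpace ℂ ι)) :=
  (PiLp.continuous_toLp 2 _).measurable

theorem lintegral_cGaussPi_eq_volume (ι : Type*) [Fintype ι] :
    ∃ C : ENNReal, C ≠ 0 ∧ C ≠ ⊤ ∧ ∀ f : EuclideanSpace ℂ ι → ENNReal, Measurable f →
      ∫⁻ x, f (WithLp.toLp 2 x) ∂(cGaussPi ι) =
        C * ∫⁻ v, ENNReal.ofReal (Real.exp (-‖v‖ ^ 2)) * f v := by
  let e : (ι → ℂ) ≃L[ℝ] EuclideanSpace ℂ ι :=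
    (PiLp.continuousLinearEquiv 2 ℝ (fun _ : ι => ℂ)).symm
  have he : ∀ x, e x = WithLp.toLp 2 x := fun x => rfl
  have : (Measure.map e volume).IsAddHaarMeasure :=
    e.isAddHaarMeasure_map volume
  obtain ⟨c, hc0, hct, hc⟩ : ∃ c : ENNReal, c ≠ 0 ∧ c ≠ ⊤ ∧
      Measure.map e volume = c • (volume : Measure (EuclideanSpace ℂ ι)) :=
    ⟨_, by simpa using (Measure.addHaarScalarFactor_pos_of_isAddHaarMeasure
      (Measure.map e volume) (volume : Measure (EuclideanSpace ℂ ι))).ne', ENNReal.coe_ne_top,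
      Measure.isAddLeftInvariant_eq_smul _ _⟩
  refine ⟨ENNReal.ofReal (Real.pi⁻¹ ^ Fintype.card ι) * c, ?_, ?_, fun f hf => ?_⟩
  · simp [hc0, Real.pi_pos]
  · exact ENNReal.mul_ne_top ENNReal.ofReal_ne_top hct
  · have hm : Measurable fun v : EuclideanSpace ℂ ι =>
      ENNReal.ofReal (Real.exp (-‖v‖ ^ 2)) * f v := by fun_prop
    have hm' : Measurable fun x => ENNReal.ofReal (Real.exp (-‖e x‖ ^ 2)) * f (e x) :=
      hm.comp e.continuous.measurable
    have hf' : Measurable fun x : ι → ℂ => f (WithLp.toLp 2 x) :=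
      hf.comp measurable_toLp_euclidean
    rw [cGaussPi_eq_withDensity, lintegral_withDensity_eq_lintegral_mul _
      (by fun_prop) hf', mul_assoc, ← smul_eq_mul (a := c),
      ← lintegral_smul_measure, ← hc, lintegral_map hm e.continuous.measurable,
      ← lintegral_const_mul _ hm']
    refine lintegral_congr fun x => ?_
    rw [Pi.mul_apply, he, ← mul_assoc, ← ENNReal.ofReal_mul (by positivity), norm_toLp_sq,
      Finset.prod_mul_distrib, ← Real.exp_sum]
    simp

theorem lintegral_cGaussPi_isometry {ι : Type*} [Fintype ι]
    (L : EuclideanSpace ℂ ι ≃ₗᵢ[ℝ] EuclideanSpace ℂ ι)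
    (f : EuclideanSpace ℂ ι → ENNReal) (hf : Measurable f) :
    ∫⁻ x, f (L (WithLp.toLp 2 x)) ∂(cGaussPi ι) =
      ∫⁻ x, f (WithLp.toLp 2 x) ∂(cGaussPi ι) := by
  obtain ⟨C, -, -, h⟩ := lintegral_cGaussPi_eq_volume ι
  rw [h f hf, h (fun v => f (L v)) (hf.comp L.continuous.measurable)]
  congr 1
  have := L.measurePreserving.lintegral_comp
    (f := fun v => ENNReal.ofReal (Real.exp (-‖v‖ ^ 2)) * f v) (by fun_prop)
  simpa using this

theorem lintegral_eq_lintegral_sphere {E : Type*} [NormedAddCommGroup E] [NormedSpace ℝ E]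
    [FiniteDimensional ℝ E] [Nontrivial E] [MeasurableSpace E] [BorelSpace E] (μ : Measure E)
    [μ.IsAddHaarMeasure] (f : E → ENNReal) (hf : Measurable f) :
    ∫⁻ v, f v ∂μ = ∫⁻ s, ∫⁻ r in Set.Ioi (0 : ℝ),
      ENNReal.ofReal (r ^ (Module.finrank ℝ E - 1)) * f (r • (s : E)) ∂volume ∂μ.toSphere := by
  have h0 : ∫⁻ v, f v ∂μ = ∫⁻ v : ({(0)}ᶜ : Set E), f v ∂(μ.comap (↑)) := by
    rw [lintegral_subtype_comap (measurableSet_singleton _).compl f, restrict_compl_singleton]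
  have hm : Measurable fun p : Metric.sphere (0 : E) 1 × Set.Ioi (0 : ℝ) =>
      f ((p.2 : ℝ) • (p.1 : E)) := hf.comp (by fun_prop)
  rw [h0]
  have := μ.measurePreserving_homeomorphUnitSphereProd.lintegral_comp hm
  have h2 : ∀ v : ({(0)}ᶜ : Set E), f ((((homeomorphUnitSphereProd E) v).2 : ℝ) •
      (((homeomorphUnitSphereProd E) v).1 : E)) = f v := by
    intro v
    have hv : ‖(v : E)‖ ≠ 0 := norm_ne_zero_iff.2 v.2
    simp [smul_smul, hv]
  simp_rw [h2] at this
  rw [this, lintegral_prod _ hm.aemeasurable]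
  refine lintegral_congr fun s => ?_
  have hs : Measurable fun y : Set.Ioi (0 : ℝ) => f ((y : ℝ) • (s : E)) :=
    hf.comp (by fun_prop)
  rw [Measure.volumeIoiPow, lintegral_withDensity_eq_lintegral_mul _ (by fun_prop) hs]
  exact lintegral_subtype_comap measurableSet_Ioi
    (fun r : ℝ => ENNReal.ofReal (r ^ (Module.finrank ℝ E - 1)) * f (r • (s : E)))

/-- The Gamma distribution with integer shape `k + 1` and unit scale. -/
def gammaLaw (k : ℕ) : Measure ℝ :=
  (volume.restrict (Set.Ioi 0)).withDensity fun q =>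
    ENNReal.ofReal (q ^ k * Real.exp (-q) / k.factorial)

theorem lintegral_gammaLaw (k : ℕ) (f : ℝ → ENNReal) :
    ∫⁻ q, f q ∂(gammaLaw k) =
      ∫⁻ q in Set.Ioi (0 : ℝ), ENNReal.ofReal (q ^ k * Real.exp (-q) / k.factorial) * f q := by
  rw [gammaLaw, lintegral_withDensity_eq_lintegral_mul_non_measurable _ (by fun_prop)]
  · rfl
  · exact Filter.Eventually.of_forall fun q => ENNReal.ofReal_lt_top

theorem integrableOn_pow_mul_exp_neg (k : ℕ) :
    IntegrableOn (fun q : ℝ => q ^ k * Real.exp (-q)) (Set.Ioi 0) := by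
  have := Real.GammaIntegral_convergent (s := k + 1) (by positivity)
  refine this.congr_fun (fun q hq => ?_) measurableSet_Ioi
  simp [mul_comm]

theorem integral_pow_mul_exp_neg (k : ℕ) :
    ∫ q in Set.Ioi (0 : ℝ), q ^ k * Real.exp (-q) = k.factorial := by
  rw [← Real.Gamma_nat_eq_factorial, Real.Gamma_eq_integral (by positivity)]
  refine setIntegral_congr_fun measurableSet_Ioi fun q hq => ?_
  simp [mul_comm]

theorem lintegral_pow_mul_exp_neg (k : ℕ) :
    ∫⁻ q in Set.Ioi (0 : ℝ), ENNReal.ofReal (q ^ k * Real.exp (-q)) = k.factorial := by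
  rw [← ofReal_integral_eq_lintegral_ofReal (integrableOn_pow_mul_exp_neg k),
    integral_pow_mul_exp_neg, ENNReal.ofReal_natCast]
  filter_upwards [ae_restrict_mem measurableSet_Ioi] with q hq
  have : (0 : ℝ) < q := hq
  positivity

instance (k : ℕ) : IsProbabilityMeasure (gammaLaw k) := by
  constructor
  rw [← lintegral_one, lintegral_gammaLaw]
  have : (k.factorial : ENNReal) ≠ 0 := by exact_mod_cast k.factorial_ne_zero
  simp_rw [mul_one, div_eq_mul_inv, ENNReal.ofReal_mul' (inv_nonneg.2 (Nat.cast_nonneg _))]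
  rw [lintegral_mul_const _ (by fun_prop), lintegral_pow_mul_exp_neg,
    ENNReal.ofReal_inv_of_pos (by positivity), ENNReal.ofReal_natCast]
  exact ENNReal.mul_inv_cancel this (ENNReal.natCast_ne_top _)

/-- Moments of the Gamma law, `q ^ (l - k)` with `l ≥ 0` being the exponent of the product with
the density. -/
theorem lintegral_gammaLaw_of_mul_pow (k l : ℕ) (f : ℝ → ℝ)
    (hf : ∀ q, 0 < q → q ^ k * f q = q ^ l) :
    ∫⁻ q, ENNReal.ofReal (f q) ∂(gammaLaw k) =
      ENNReal.ofReal ((l.factorial : ℝ) / k.factorial) := by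
  rw [lintegral_gammaLaw, div_eq_mul_inv, ENNReal.ofReal_mul (by positivity),
    ENNReal.ofReal_natCast, ← lintegral_pow_mul_exp_neg, ← lintegral_mul_const _ (by fun_prop)]
  refine setLIntegral_congr_fun measurableSet_Ioi fun q hq => ?_
  have hq : (0 : ℝ) < q := hq
  rw [← ENNReal.ofReal_mul (by positivity), ← ENNReal.ofReal_mul (by positivity), ← hf q hq]
  congr 1
  ring

theorem lintegral_Ioi_comp_sq (f : ℝ → ENNReal) :
    ∫⁻ q in Set.Ioi (0 : ℝ), f q = ∫⁻ r in Set.Ioi (0 : ℝ), ENNReal.ofReal (2 * r) * f (r ^ 2) := by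
  have him : (fun r : ℝ => r ^ 2) '' Set.Ioi 0 = Set.Ioi 0 := by
    ext q
    constructor
    · rintro ⟨r, hr, rfl⟩
      exact pow_pos (Set.mem_Ioi.1 hr) 2
    · intro hq
      exact ⟨√q, Real.sqrt_pos.2 hq, Real.sq_sqrt (le_of_lt hq)⟩
  have hd : ∀ r ∈ Set.Ioi (0 : ℝ),
      HasDerivWithinAt (fun r : ℝ => r ^ 2) (2 * r) (Set.Ioi 0) r := fun r _ => by
    simpa using (hasDerivAt_pow 2 r).hasDerivWithinAt
  have hinj : Set.InjOn (fun r : ℝ => r ^ 2) (Set.Ioi 0) := fun a ha b hb h => by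
    exact (pow_left_inj₀ (le_of_lt ha) (le_of_lt hb) two_ne_zero).1 h
  have := lintegral_image_eq_lintegral_abs_deriv_mul measurableSet_Ioi hd hinj f
  rw [him] at this
  rw [this]
  refine setLIntegral_congr_fun measurableSet_Ioi fun r hr => ?_
  have hr : (0 : ℝ) < r := hr
  rw [abs_of_pos (by positivity)]

theorem finrank_real_euclideanSpace_complex (ι : Type*) [Fintype ι] :
    Module.finrank ℝ (EuclideanSpace ℂ ι) = 2 * Fintype.card ι := by
  have h := finrank_real_of_complex (EuclideanSpace ℂ ι)
  rw [finrank_euclideanSpace] at h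
  exact h

theorem lintegral_cGaussPi_polar (ι : Type*) [Fintype ι] {k : ℕ} (hk : Fintype.card ι = k + 1) :
    ∃ C : ENNReal, C ≠ 0 ∧ C ≠ ⊤ ∧ ∀ f : EuclideanSpace ℂ ι → ENNReal, Measurable f →
      ∫⁻ x, f (WithLp.toLp 2 x) ∂(cGaussPi ι) =
        C * ∫⁻ s, ∫⁻ r in Set.Ioi (0 : ℝ), ENNReal.ofReal (r ^ (2 * k + 1) * Real.exp (-r ^ 2)) *
          f (r • (s : EuclideanSpace ℂ ι)) ∂volume
          ∂((volume : Measure (EuclideanSpace ℂ ι)).toSphere) := by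
  obtain ⟨C, h0, ht, h⟩ := lintegral_cGaussPi_eq_volume ι
  refine ⟨C, h0, ht, fun f hf => ?_⟩
  have hfr := finrank_real_euclideanSpace_complex ι
  have : Nontrivial (EuclideanSpace ℂ ι) := Module.nontrivial_of_finrank_pos (R := ℝ) (by omega)
  rw [h f hf, lintegral_eq_lintegral_sphere _ _ (by fun_prop)]
  congr 1
  refine lintegral_congr fun s => setLIntegral_congr_fun measurableSet_Ioi fun r hr => ?_
  have hr : (0 : ℝ) < r := hr
  have hs : ‖(s : EuclideanSpace ℂ ι)‖ = 1 := by simp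
  rw [← mul_assoc, ← ENNReal.ofReal_mul (by positivity), norm_smul, hs, hfr, hk,
    show 2 * (k + 1) - 1 = 2 * k + 1 by omega]
  simp

theorem lintegral_cGaussPi_norm_sq {ι : Type*} [Fintype ι] {k : ℕ} (hk : Fintype.card ι = k + 1)
    (f : ℝ → ENNReal) (hf : Measurable f) :
    ∫⁻ x, f (∑ i, ‖x i‖ ^ 2) ∂(cGaussPi ι) = ∫⁻ q, f q ∂(gammaLaw k) := by
  obtain ⟨C, -, -, h⟩ := lintegral_cGaussPi_polar ι hk
  have key : ∃ D : ENNReal, ∀ f : ℝ → ENNReal, Measurable f →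
      ∫⁻ x, f (∑ i, ‖x i‖ ^ 2) ∂(cGaussPi ι) = D * ∫⁻ q, f q ∂(gammaLaw k) := by
    refine ⟨C * (volume : Measure (EuclideanSpace ℂ ι)).toSphere Set.univ *
      ENNReal.ofReal (k.factorial / 2), fun f hf => ?_⟩
    have h1 := h (fun v => f (‖v‖ ^ 2)) (by fun_prop)
    simp_rw [norm_toLp_sq] at h1
    have h2 : ∀ s : Metric.sphere (0 : EuclideanSpace ℂ ι) 1,
        ∫⁻ r in Set.Ioi (0 : ℝ), ENNReal.ofReal (r ^ (2 * k + 1) * Real.exp (-r ^ 2)) *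
          f (‖r • (s : EuclideanSpace ℂ ι)‖ ^ 2) =
        ENNReal.ofReal (k.factorial / 2) * ∫⁻ q, f q ∂(gammaLaw k) := by
      intro s
      rw [lintegral_gammaLaw, lintegral_Ioi_comp_sq
        (fun q => ENNReal.ofReal (q ^ k * Real.exp (-q) / k.factorial) * f q),
        ← lintegral_const_mul _ (by fun_prop)]
      refine setLIntegral_congr_fun measurableSet_Ioi fun r hr => ?_
      have hr : (0 : ℝ) < r := hr
      have hs : ‖(s : EuclideanSpace ℂ ι)‖ = 1 := by simp
      rw [← mul_assoc, ← mul_assoc, ← ENNReal.ofReal_mul (by positivity),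
        ← ENNReal.ofReal_mul (by positivity), norm_smul, hs]
      have : (k.factorial : ℝ) ≠ 0 := by positivity
      congr 2
      · field_simp
        ring
      · simp
    rw [h1]
    simp_rw [h2]
    rw [lintegral_const]
    ring
  obtain ⟨D, hD⟩ := key
  have h1 := hD (fun _ => 1) measurable_const
  simp only [lintegral_const, measure_univ, mul_one] at h1
  rw [hD f hf, ← h1, one_mul]

theorem lintegral_sphereUniform {m n k : ℕ} (hk : m * n = k + 1)
    (G : TensorSp m n → ENNReal) (hG : Measurable G)
    (hom : ∀ r : ℝ, 0 < r → ∀ v, G (r • v) = ENNReal.ofReal (r ^ 2) * G v) :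
    ∫⁻ x, G (WithLp.toLp 2 x) ∂(cGaussPi (Fin m × Fin n)) =
      ENNReal.ofReal (m * n) * ∫⁻ s, G (s : TensorSp m n) ∂(sphereUniform m n) := by
  have hc : Fintype.card (Fin m × Fin n) = k + 1 := by simpa using hk
  obtain ⟨C, -, -, h⟩ := lintegral_cGaussPi_polar (Fin m × Fin n) hc
  have : Nontrivial (TensorSp m n) := Module.nontrivial_of_finrank_pos (R := ℝ) (by
    rw [finrank_real_euclideanSpace_complex, hc]; omega)
  have hS0 : (volume : Measure (TensorSp m n)).toSphere Set.univ ≠ 0 := by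
    exact Measure.measure_univ_ne_zero.2 (Measure.toSphere_ne_zero _)
  have hSt : (volume : Measure (TensorSp m n)).toSphere Set.univ ≠ ⊤ := measure_ne_top _ _
  have key : ∃ D : ENNReal, ∀ G : TensorSp m n → ENNReal, Measurable G →
      (∀ r : ℝ, 0 < r → ∀ v, G (r • v) = ENNReal.ofReal (r ^ 2) * G v) →
      ∫⁻ x, G (WithLp.toLp 2 x) ∂(cGaussPi (Fin m × Fin n)) =
        D * ∫⁻ s, G (s : TensorSp m n) ∂(sphereUniform m n) := by
    refine ⟨C * (∫⁻ r in Set.Ioi (0 : ℝ), ENNReal.ofReal (r ^ (2 * k + 1) * Real.exp (-r ^ 2)) *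
      ENNReal.ofReal (r ^ 2)) * (volume : Measure (TensorSp m n)).toSphere Set.univ,
      fun G hG hom => ?_⟩
    rw [h G hG, sphereUniform, lintegral_smul_measure, smul_eq_mul, mul_assoc, mul_assoc,
      ← mul_assoc (Measure.toSphere volume Set.univ), ENNReal.mul_inv_cancel hS0 hSt, one_mul]
    congr 1
    rw [← lintegral_const_mul _ (by fun_prop)]
    refine lintegral_congr fun s => ?_
    rw [← lintegral_mul_const _ (by fun_prop)]
    refine setLIntegral_congr_fun measurableSet_Ioi fun r hr => ?_
    rw [hom r hr, mul_assoc]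
  obtain ⟨D, hD⟩ := key
  have hprob : sphereUniform m n Set.univ = 1 := by
    rw [sphereUniform, Measure.smul_apply, smul_eq_mul, ENNReal.inv_mul_cancel hS0 hSt]
  have h1 := hD (fun v => ENNReal.ofReal (‖v‖ ^ 2)) (by fun_prop) (fun r hr v => by
    rw [norm_smul, mul_pow, ENNReal.ofReal_mul (by positivity), Real.norm_of_nonneg hr.le])
  have h2 : ∀ s : Metric.sphere (0 : TensorSp m n) 1, ‖(s : TensorSp m n)‖ = 1 :=
    fun s => by simp
  simp only [norm_toLp_sq, h2, one_pow, ENNReal.ofReal_one, lintegral_const, hprob, mul_one] at h1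
  rw [lintegral_cGaussPi_norm_sq hc (fun q => ENNReal.ofReal q) (by fun_prop),
    lintegral_gammaLaw_of_mul_pow k (k + 1) _ (fun q _ => by ring)] at h1
  rw [hD G hG hom, ← h1]
  congr 2
  rw [Nat.factorial_succ]
  have : (k.factorial : ℝ) ≠ 0 := by positivity
  push_cast
  field_simp
  exact_mod_cast hk.symm

theorem lintegral_cGaussPi_unitary_mulVec {ι : Type*} [Fintype ι] [DecidableEq ι]
    (U : unitaryGroup ι ℂ) (f : (ι → ℂ) → ENNReal) (hf : Measurable f) :
    ∫⁻ x, f ((U : Matrix ι ι ℂ) *ᵥ x) ∂(cGaussPi ι) = ∫⁻ x, f x ∂(cGaussPi ι) := by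
  let l : EuclideanSpace ℂ ι →ₗᵢ[ℝ] EuclideanSpace ℂ ι :=
    { toFun := fun v => WithLp.toLp 2 ((U : Matrix ι ι ℂ) *ᵥ WithLp.ofLp v)
      map_add' := fun v w => by simp [mulVec_add]
      map_smul' := fun c v => by simp [mulVec_smul]
      norm_map' := fun v => by
        have h : ∀ w : EuclideanSpace ℂ ι,
            ((‖w‖ ^ 2 : ℝ) : ℂ) = star (WithLp.ofLp w) ⬝ᵥ (WithLp.ofLp w) := fun w => by
          rw [EuclideanSpace.norm_sq_eq, dotProduct]
          push_cast
          refine Finset.sum_congr rfl fun i _ => ?_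
          rw [Pi.star_apply, ← Complex.conj_mul']
          rfl
        have h2 : ((‖WithLp.toLp 2 ((U : Matrix ι ι ℂ) *ᵥ WithLp.ofLp v)‖ ^ 2 : ℝ) : ℂ) =
            ((‖v‖ ^ 2 : ℝ) : ℂ) := by
          rw [h, h]
          simp only
          rw [star_mulVec, dotProduct_mulVec, vecMul_vecMul, ← star_eq_conjTranspose,
            UnitaryGroup.star_mul_self, vecMul_one]
        exact (pow_left_inj₀ (norm_nonneg _) (norm_nonneg _) two_ne_zero).1
          (Complex.ofReal_injective h2) }
  have h := lintegral_cGaussPi_isometry (l.toLinearIsometryEquiv rfl) (fun v => f (WithLp.ofLp v))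
    (hf.comp (PiLp.continuous_ofLp 2 _).measurable)
  exact h

/-- The Gaussian law of a Hermitian form is the law of its diagonalization. -/
theorem lintegral_cGaussPi_hermitian {ι : Type*} [Fintype ι] [DecidableEq ι]
    {W : Matrix ι ι ℂ} (hW : W.IsHermitian) (f : ℝ → ENNReal) (hf : Measurable f) :
    ∫⁻ x, f (star x ⬝ᵥ W *ᵥ x).re ∂(cGaussPi ι) =
      ∫⁻ x, f (∑ a, hW.eigenvalues a * ‖x a‖ ^ 2) ∂(cGaussPi ι) := by
  rw [← lintegral_cGaussPi_unitary_mulVec (star hW.eigenvectorUnitary)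
    (fun x => f (∑ a, hW.eigenvalues a * ‖x a‖ ^ 2)) (by fun_prop)]
  refine lintegral_congr fun x => ?_
  congr 1
  have h : star x ⬝ᵥ W *ᵥ x =
      ((∑ a, hW.eigenvalues a *
        ‖((star hW.eigenvectorUnitary : unitaryGroup ι ℂ) : Matrix ι ι ℂ).mulVec x a‖ ^ 2 : ℝ) :
          ℂ) := by
    conv_lhs => rw [hW.spectral_theorem]
    rw [Unitary.conjStarAlgAut_apply, ← mulVec_mulVec, ← mulVec_mulVec, dotProduct_mulVec]
    set y := ((star hW.eigenvectorUnitary : unitaryGroup ι ℂ) : Matrix ι ι ℂ).mulVec x with hy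
    have h1 : star x ᵥ* (hW.eigenvectorUnitary : Matrix ι ι ℂ) = star y := by
      rw [hy, star_mulVec]
      simp [star_eq_conjTranspose]
    have h2 : star (hW.eigenvectorUnitary : Matrix ι ι ℂ) *ᵥ x = y := rfl
    rw [h1, h2, dotProduct]
    push_cast
    refine Finset.sum_congr rfl fun a _ => ?_
    rw [mulVec_diagonal, ← Complex.conj_mul']
    simp only [Pi.star_apply, Function.comp_apply, RCLike.star_def, Complex.coe_algebraMap]
    ring
  rw [h, Complex.ofReal_re]

theorem lintegral_apply_cGaussPi {ι : Type*} [Fintype ι] (i : ι) (f : ℂ → ENNReal)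
    (hf : Measurable f) : ∫⁻ x, f (x i) ∂(cGaussPi ι) = ∫⁻ z, f z ∂cGauss :=
  (measurePreserving_eval (fun _ : ι => cGauss) i).lintegral_comp hf

theorem lintegral_cGaussPi_exp {ι : Type*} [Fintype ι] (s : ι → ℝ) (hs : ∀ i, 0 ≤ s i) :
    ∫⁻ x, ENNReal.ofReal (Real.exp (-∑ i, s i * ‖x i‖ ^ 2)) ∂(cGaussPi ι) =
      ENNReal.ofReal (∏ i, (1 + s i))⁻¹ := by
  have h := ProbabilityTheory.lintegral_prod_eq_prod_lintegral_of_indepFun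
    (μ := Measure.pi fun _ : ι => cGauss) Finset.univ
    (fun i x => ENNReal.ofReal (Real.exp (-(s i * ‖x i‖ ^ 2))))
    (ProbabilityTheory.iIndepFun_pi
      (X := fun i z => ENNReal.ofReal (Real.exp (-(s i * ‖z‖ ^ 2)))) (fun i => by fun_prop))
    (fun i => by fun_prop)
  have he (i : ι) : ∫⁻ x, ENNReal.ofReal (Real.exp (-(s i * ‖x i‖ ^ 2)))
      ∂(Measure.pi fun _ : ι => cGauss) = ENNReal.ofReal (1 / (1 + s i)) := by
    rw [← lintegral_cGauss _ (hs i)]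
    exact lintegral_apply_cGaussPi i
      (fun z => ENNReal.ofReal (Real.exp (-(s i * ‖z‖ ^ 2)))) (by fun_prop)
  simp_rw [he] at h
  rw [← ENNReal.ofReal_prod_of_nonneg fun i _ => by have := hs i; positivity] at h
  simp_rw [← Finset.prod_inv_distrib, ← one_div, cGaussPi]
  rw [← h]
  refine lintegral_congr fun x => ?_
  rw [← ENNReal.ofReal_prod_of_nonneg fun i _ => by positivity, ← Real.exp_sum]
  simp

theorem lintegral_cGaussPi_apply_sq {ι : Type*} [Fintype ι] (i : ι) :
    ∫⁻ x, ENNReal.ofReal (‖x i‖ ^ 2) ∂(cGaussPi ι) = 1 := by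
  rw [lintegral_apply_cGaussPi i (fun z => ENNReal.ofReal (‖z‖ ^ 2)) (by fun_prop)]
  have h1 := lintegral_cGaussPi_norm_sq (ι := Fin 1) (k := 0) (by simp)
    (fun q => ENNReal.ofReal q) (by fun_prop)
  rw [lintegral_gammaLaw_of_mul_pow 0 1 _ (fun q _ => by ring)] at h1
  simp only [Finset.univ_unique, Finset.sum_singleton] at h1
  rw [lintegral_apply_cGaussPi _ (fun z => ENNReal.ofReal (‖z‖ ^ 2)) (by fun_prop)] at h1
  rw [h1]
  simp

section GramPoly

open Polynomial

variable {ι κ : Type*} [Fintype ι] [DecidableEq ι] [Fintype κ]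

/-- The eigenvalues of `A * Aᴴ`. -/
def gramEig (A : Matrix ι κ ℂ) : ι → ℝ := (isHermitian_mul_conjTranspose_self A).eigenvalues

open scoped ComplexOrder in
theorem gramEig_nonneg (A : Matrix ι κ ℂ) (a : ι) : 0 ≤ gramEig A a :=
  (posSemidef_self_mul_conjTranspose A).eigenvalues_nonneg a

/-- The real polynomial `det (X + A * Aᴴ)`. -/
def gramPoly (A : Matrix ι κ ℂ) : ℝ[X] := ∏ a, (X + C (gramEig A a))

theorem charpoly_mul_conjTranspose (A : Matrix ι κ ℂ) :
    (A * Aᴴ).charpoly = ∏ a, (X - C (gramEig A a : ℂ)) :=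
  (isHermitian_mul_conjTranspose_self A).charpoly_eq

theorem map_gramPoly (A : Matrix ι κ ℂ) :
    (gramPoly A).map Complex.ofRealHom =
      (-1) ^ Fintype.card ι * (A * Aᴴ).charpoly.comp (-X) := by
  rw [charpoly_mul_conjTranspose, gramPoly, Polynomial.map_prod, Polynomial.prod_comp,
    ← Finset.card_univ, ← Finset.prod_const, ← Finset.prod_mul_distrib]
  refine Finset.prod_congr rfl fun a _ => ?_
  simp
  ring

theorem gramPoly_eq_of_charpoly_eq {κ' : Type*} [Fintype κ'] {A : Matrix ι κ ℂ}
    {B : Matrix ι κ' ℂ} (h : (A * Aᴴ).charpoly = (B * Bᴴ).charpoly) : gramPoly A = gramPoly B :=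
  Polynomial.map_injective _ Complex.ofRealHom.injective (by rw [map_gramPoly, map_gramPoly, h])

theorem eval_gramPoly (A : Matrix ι κ ℂ) (t : ℝ) :
    (gramPoly A).eval t = ∏ a, (t + gramEig A a) := by
  simp [gramPoly, eval_prod]

theorem eval_gramPoly_pos (A : Matrix ι κ ℂ) {t : ℝ} (ht : 0 < t) : 0 < (gramPoly A).eval t := by
  rw [eval_gramPoly]
  exact Finset.prod_pos fun a _ => add_pos_of_pos_of_nonneg ht (gramEig_nonneg A a)

theorem ofReal_eval_gramPoly (A : Matrix ι κ ℂ) (t : ℝ) :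
    (((gramPoly A).eval t : ℝ) : ℂ) = (scalar ι (t : ℂ) + A * Aᴴ).det := by
  have h : (((gramPoly A).eval t : ℝ) : ℂ) = ((gramPoly A).map Complex.ofRealHom).eval (t : ℂ) :=
    (eval_map_apply (Complex.ofRealHom) t).symm
  rw [h, map_gramPoly, eval_mul, eval_comp, eval_charpoly, eval_pow, eval_neg, eval_neg, eval_one,
    eval_X, ← det_neg]
  congr 1
  rw [map_neg]
  abel

theorem gramPoly_natDegree (A : Matrix ι κ ℂ) : (gramPoly A).natDegree = Fintype.card ι := by
  rw [gramPoly, natDegree_prod_of_monic _ _ fun a _ => monic_X_add_C _]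
  simp

theorem gramPoly_coeff (A : Matrix ι κ ℂ) {k : ℕ} (h : k ≤ Fintype.card ι) :
    (gramPoly A).coeff k =
      ∑ t ∈ Finset.univ.powersetCard (Fintype.card ι - k), ∏ a ∈ t, gramEig A a :=
  Finset.prod_X_add_C_coeff _ _ h

theorem gramPoly_coeff_nonneg (A : Matrix ι κ ℂ) (k : ℕ) : 0 ≤ (gramPoly A).coeff k := by
  rcases le_or_gt k (Fintype.card ι) with h | h
  · rw [gramPoly_coeff A h]
    exact Finset.sum_nonneg fun t _ => Finset.prod_nonneg fun a _ => gramEig_nonneg A a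
  · rw [coeff_eq_zero_of_natDegree_lt (by rwa [gramPoly_natDegree])]

theorem sum_gramEig (A : Matrix ι κ ℂ) : ∑ a, gramEig A a = ∑ a, ∑ j, ‖A a j‖ ^ 2 := by
  have h : ((∑ a, gramEig A a : ℝ) : ℂ) = ((∑ a, ∑ j, ‖A a j‖ ^ 2 : ℝ) : ℂ) := by
    push_cast
    refine (isHermitian_mul_conjTranspose_self A).trace_eq_sum_eigenvalues.symm.trans ?_
    rw [trace]
    refine Finset.sum_congr rfl fun a _ => ?_
    rw [diag_apply, mul_apply]
    refine Finset.sum_congr rfl fun j _ => ?_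
    rw [conjTranspose_apply, ← Complex.mul_conj']
    rfl
  exact_mod_cast h

theorem gramPoly_coeff_card_sub_one (A : Matrix ι κ ℂ) {k : ℕ} (hk : Fintype.card ι = k + 1) :
    (gramPoly A).coeff k = ∑ a, ∑ j, ‖A a j‖ ^ 2 := by
  rw [gramPoly_coeff A (by omega), ← sum_gramEig, show Fintype.card ι - k = 1 by omega,
    Finset.powersetCard_one, Finset.sum_map]
  simp

theorem gramPoly_coeff_card (A : Matrix ι κ ℂ) : (gramPoly A).coeff (Fintype.card ι) = 1 := by
  rw [gramPoly_coeff A le_rfl]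
  simp

theorem gramPoly_transpose [DecidableEq κ] (A : Matrix ι κ ℂ)
    (h : Fintype.card ι ≤ Fintype.card κ) :
    gramPoly Aᵀ = X ^ (Fintype.card κ - Fintype.card ι) * gramPoly A := by
  refine Polynomial.map_injective _ Complex.ofRealHom.injective ?_
  have h1 : (Aᵀ * Aᵀᴴ).charpoly =
      X ^ (Fintype.card κ - Fintype.card ι) * (A * Aᴴ).charpoly := by
    rw [charpoly_mul_comm_of_le _ _ h, ← charpoly_transpose (Aᵀᴴ * Aᵀ), transpose_mul]
    rfl
  rw [Polynomial.map_mul, map_gramPoly, map_gramPoly, h1, mul_comp, Polynomial.map_pow, map_X,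
    pow_comp, X_comp, neg_pow (X : ℂ[X])]
  nth_rewrite 1 [← Nat.sub_add_cancel h]
  have h2 : ((-1 : ℂ[X]) ^ (Fintype.card κ - Fintype.card ι)) ^ 2 = 1 := by
    rw [← pow_mul, pow_mul', neg_one_sq, one_pow]
  rw [pow_add]
  linear_combination ((-1) ^ Fintype.card ι * X ^ (Fintype.card κ - Fintype.card ι) *
    (A * Aᴴ).charpoly.comp (-X)) * h2

theorem gramPoly_unitary_mul_transpose (U : unitaryGroup ι ℂ) [DecidableEq κ] (A : Matrix ι κ ℂ) :
    gramPoly ((U : Matrix ι ι ℂ) * A)ᵀ = gramPoly Aᵀ := by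
  refine gramPoly_eq_of_charpoly_eq ?_
  rw [← charpoly_transpose, ← charpoly_transpose (Aᵀ * _), transpose_mul _ (_ᴴ), transpose_mul Aᵀ,
    transpose_transpose, transpose_transpose]
  have h (B : Matrix ι κ ℂ) : Bᵀᴴᵀ = Bᴴ := rfl
  rw [h, h, conjTranspose_mul, Matrix.mul_assoc, ← Matrix.mul_assoc _ _ A,
    ← star_eq_conjTranspose (U : Matrix ι ι ℂ), UnitaryGroup.star_mul_self, Matrix.one_mul]

theorem sum_gramEig_div (A : Matrix ι κ ℂ) {t : ℝ} (ht : 0 < t) :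
    ∑ a, gramEig A a / (gramEig A a + t) = (∑ j ∈ Finset.range (Fintype.card ι + 1),
      ((Fintype.card ι : ℝ) - j) * (gramPoly A).coeff j * t ^ j) / (gramPoly A).eval t := by
  have hpos : ∀ a, 0 < t + gramEig A a := fun a =>
    add_pos_of_pos_of_nonneg ht (gramEig_nonneg A a)
  have hP := eval_gramPoly_pos A ht
  have h1 : (derivative (gramPoly A)).eval t =
      (gramPoly A).eval t * ∑ a, (t + gramEig A a)⁻¹ := by
    rw [eval_gramPoly, gramPoly, derivative_prod_finset, eval_finsetSum, Finset.mul_sum]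
    refine Finset.sum_congr rfl fun a _ => ?_
    rw [← Finset.mul_prod_erase _ _ (Finset.mem_univ a)]
    have := (hpos a).ne'
    simp [eval_prod]
    field_simp
  have h2 : ∑ j ∈ Finset.range (Fintype.card ι + 1),
      ((Fintype.card ι : ℝ) - j) * (gramPoly A).coeff j * t ^ j =
      Fintype.card ι * (gramPoly A).eval t - t * (derivative (gramPoly A)).eval t := by
    rw [derivative_eval, sum_over_range' _ (fun n => by simp) (Fintype.card ι + 1)
      (by rw [gramPoly_natDegree]; omega), eval_eq_sum_range, gramPoly_natDegree,
      Finset.mul_sum, Finset.mul_sum, ← Finset.sum_sub_distrib]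
    refine Finset.sum_congr rfl fun j _ => ?_
    rcases j with _ | j
    · simp
    · push_cast
      ring
  rw [h2, h1, eq_div_iff hP.ne', ← Finset.card_univ, Finset.card_eq_sum_ones]
  push_cast
  rw [Finset.sum_mul, Finset.sum_mul, Finset.mul_sum, Finset.mul_sum, ← Finset.sum_sub_distrib]
  refine Finset.sum_congr rfl fun a _ => ?_
  have := (hpos a).ne'
  have h3 : gramEig A a + t ≠ 0 := by rwa [add_comm]
  field_simp
  ring

theorem measurable_gramPoly_coeff {Ω : Type*} [MeasurableSpace Ω] {A : Ω → Matrix ι κ ℂ}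
    (hA : ∀ i j, Measurable fun ω => A ω i j) (k : ℕ) :
    Measurable fun ω => (gramPoly (A ω)).coeff k := by
  have hprod (s : Finset ι) (f : ι → Ω → ℂ[X]) (hf : ∀ i k, Measurable fun ω => (f i ω).coeff k) :
      ∀ k, Measurable fun ω => (∏ i ∈ s, f i ω).coeff k := by
    induction s using Finset.induction_on with
    | empty => intro k; simp
    | insert a s ha ih =>
      intro k
      simp_rw [Finset.prod_insert ha, coeff_mul]
      exact Finset.measurable_fun_sum _ fun p _ => (hf a _).mul (ih _)
  have hW : ∀ i j, Measurable fun ω => (A ω * (A ω)ᴴ) i j := fun i j => by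
    simp_rw [mul_apply, conjTranspose_apply]
    refine Finset.measurable_fun_sum _ fun p _ => (hA i p).mul ?_
    exact Complex.continuous_conj.measurable.comp (hA j p)
  have hch : ∀ k, Measurable fun ω => ((A ω * (A ω)ᴴ).charpoly).coeff k := fun k => by
    simp_rw [charpoly, det_apply', finsetSum_coeff, ← Polynomial.C_eq_intCast, coeff_C_mul]
    refine Finset.measurable_fun_sum _ fun σ _ =>
      Measurable.const_mul (hprod _ _ (fun i k => ?_) k) _
    simp_rw [charmatrix_apply, coeff_sub, diagonal_apply]
    refine Measurable.sub measurable_const ?_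
    simp_rw [coeff_C]
    split_ifs
    · exact hW _ _
    · exact measurable_const
  have h : ∀ ω, (gramPoly (A ω)).coeff k = ((-1) ^ Fintype.card ι *
      ((-1) ^ k * (A ω * (A ω)ᴴ).charpoly.coeff k)).re := fun ω => by
    have h1 : (((gramPoly (A ω)).coeff k : ℝ) : ℂ) =
      ((gramPoly (A ω)).map Complex.ofRealHom).coeff k := by rw [coeff_map]; rfl
    rw [map_gramPoly, ← neg_one_mul (X : ℂ[X]), ← map_one (C : ℂ →+* ℂ[X]), ← map_neg C,
      ← map_pow C, coeff_C_mul,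
      comp_C_mul_X_coeff, mul_comm _ ((-1) ^ k)] at h1
    rw [← h1, Complex.ofReal_re]
  simp_rw [h]
  exact Complex.measurable_re.comp (((hch k).const_mul _).const_mul _)

end GramPoly

open scoped Kronecker in
theorem lintegral_cGaussPi_unitary_mul {ι κ : Type*} [Fintype ι] [DecidableEq ι] [Fintype κ]
    (U : unitaryGroup ι ℂ) (f : (ι × κ → ℂ) → ENNReal) (hf : Measurable f) :
    ∫⁻ x, f (fun p => ∑ i, (U : Matrix ι ι ℂ) p.1 i * x (i, p.2)) ∂(cGaussPi (ι × κ)) =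
      ∫⁻ x, f x ∂(cGaussPi (ι × κ)) := by
  classical
  let V : unitaryGroup (ι × κ) ℂ :=
    ⟨(U : Matrix ι ι ℂ) ⊗ₖ (1 : Matrix κ κ ℂ), kronecker_mem_unitary U.2 (one_mem _)⟩
  rw [← lintegral_cGaussPi_unitary_mulVec V f hf]
  refine lintegral_congr fun x => congrArg f (funext fun p => ?_)
  change _ = ∑ q : ι × κ, _ * _
  rw [Fintype.sum_prod_type]
  refine Finset.sum_congr rfl fun i _ => ?_
  rw [Finset.sum_eq_single p.2]
  · simp [V]
  · intro k _ hk
    simp [V, one_apply_ne hk.symm]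
  · simp

/-- Every vector of `ℂ^ι` is, up to a positive factor, the conjugate of a prescribed row of a
unitary matrix. -/
theorem exists_unitary_row {ι : Type*} [Fintype ι] [DecidableEq ι] (a₀ : ι) (y : ι → ℂ) :
    ∃ U : unitaryGroup ι ℂ, ∀ i, star (y i) =
      (√(∑ i, ‖y i‖ ^ 2) : ℝ) * (U : Matrix ι ι ℂ) a₀ i := by
  by_cases hy : y = 0
  · exact ⟨1, fun i => by simp [hy]⟩
  set w : EuclideanSpace ℂ ι := WithLp.toLp 2 y with hw
  have hw0 : w ≠ 0 := fun h => hy (by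
    have := congrArg WithLp.ofLp h
    simpa [hw] using this)
  have hnorm : √(∑ i, ‖y i‖ ^ 2) = ‖w‖ := by
    rw [← norm_toLp_sq, Real.sqrt_sq (norm_nonneg _)]
  have hwn : ‖w‖ ≠ 0 := norm_ne_zero_iff.2 hw0
  let u : EuclideanSpace ℂ ι := ((‖w‖⁻¹ : ℝ) : ℂ) • w
  have hu : ‖u‖ = 1 := by
    simp [u, norm_smul, hwn]
  have ho : Orthonormal ℂ (({a₀} : Set ι).domRestrict fun _ : ι => u) := by
    refine ⟨fun _ => hu, fun i j hij => (hij (Subsingleton.elim _ _)).elim⟩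
  obtain ⟨b, hb⟩ := ho.exists_orthonormalBasis_extension_of_card_eq (by simp)
  have hb0 : b a₀ = u := hb a₀ rfl
  refine ⟨⟨Matrix.of fun a i => star (b a i), mem_unitaryGroup_iff.2 ?_⟩, fun i => ?_⟩
  · ext a a'
    rw [star_eq_conjTranspose, mul_apply, one_apply]
    have := orthonormal_iff_ite.1 b.orthonormal a a'
    rw [← this, PiLp.inner_apply]
    refine Finset.sum_congr rfl fun i _ => ?_
    simp [mul_comm]
  · rw [hnorm]
    simp only [of_apply, hb0, u]
    have : (‖w‖ : ℂ) ≠ 0 := by exact_mod_cast hwn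
    simp only [PiLp.smul_apply, smul_eq_mul, star_mul', RCLike.star_def, Complex.conj_ofReal]
    rw [Complex.ofReal_inv]
    rw [mul_inv_cancel_left₀ this, hw]

theorem re_star_dotProduct_mul_conjTranspose {ι κ : Type*} [Fintype ι] [Fintype κ]
    (x : ι × κ → ℂ) (y : ι → ℂ) :
    (star y ⬝ᵥ ((Matrix.of fun i j => x (i, j)) *
      (Matrix.of fun i j => x (i, j))ᴴ) *ᵥ y).re = ∑ j, ‖∑ i, star (y i) * x (i, j)‖ ^ 2 := by
  have : (star y ⬝ᵥ ((Matrix.of fun i j => x (i, j)) *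
      (Matrix.of fun i j => x (i, j))ᴴ) *ᵥ y) =
      ((∑ j, ‖∑ i, star (y i) * x (i, j)‖ ^ 2 : ℝ) : ℂ) := by
    rw [← mulVec_mulVec, dotProduct_mulVec, dotProduct]
    push_cast
    refine Finset.sum_congr rfl fun j _ => ?_
    rw [← Complex.mul_conj']
    simp [vecMul, mulVec, dotProduct, mul_comm]
  rw [this, Complex.ofReal_re]

theorem ofReal_inv_prod_gramEig {ι κ : Type*} [Fintype ι] [DecidableEq ι] [Fintype κ]
    {s : ℝ} (hs : 0 ≤ s) (x : ι × κ → ℂ) : ENNReal.ofReal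
      (∏ a, (1 + s * gramEig (Matrix.of fun i j => x (i, j)) a))⁻¹ =
    ∫⁻ y, ENNReal.ofReal (Real.exp (-(s * ∑ j, ‖∑ i, star (y i) * x (i, j)‖ ^ 2)))
      ∂(cGaussPi ι) := by
  rw [← lintegral_cGaussPi_exp _ fun a => mul_nonneg hs (gramEig_nonneg _ a)]
  have := lintegral_cGaussPi_hermitian
    (isHermitian_mul_conjTranspose_self (Matrix.of fun i j => x (i, j)))
    (fun q => ENNReal.ofReal (Real.exp (-(s * q)))) (by fun_prop)
  simp_rw [re_star_dotProduct_mul_conjTranspose, Finset.mul_sum] at this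
  simp_rw [Finset.mul_sum, this, gramEig, mul_assoc]

theorem ofReal_inv_pow_row {ι κ : Type*} [Fintype ι] [Fintype κ]
    (a₀ : ι) {s : ℝ} (hs : 0 ≤ s) (x : ι × κ → ℂ) : ENNReal.ofReal
      ((1 + s * ∑ j, ‖x (a₀, j)‖ ^ 2) ^ Fintype.card ι)⁻¹ =
    ∫⁻ y, ENNReal.ofReal (Real.exp (-(s * ((∑ i : ι, ‖y i‖ ^ 2) * ∑ j, ‖x (a₀, j)‖ ^ 2))))
      ∂(cGaussPi ι) := by
  have hn : 0 ≤ s * ∑ j, ‖x (a₀, j)‖ ^ 2 := by positivity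
  have := lintegral_cGaussPi_exp (fun _ : ι => s * ∑ j, ‖x (a₀, j)‖ ^ 2) fun a => hn
  rw [Finset.prod_const, Finset.card_univ] at this
  rw [← this]
  refine lintegral_congr fun y => ?_
  rw [← Finset.mul_sum]
  ring_nf

/-- Averaging a function invariant under left multiplication by unitary matrices against
`1 / det (1 + s * X * Xᴴ)`: the determinant may be replaced by a power of `1 + s * ‖x‖ ^ 2`,
where `x` is a row of `X`. -/
theorem lintegral_mul_inv_prod_gramEig {ι κ : Type*} [Fintype ι] [DecidableEq ι] [Fintype κ]
    (a₀ : ι) (Φ : (ι × κ → ℂ) → ENNReal) (hΦ : Measurable Φ)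
    (hinv : ∀ (U : unitaryGroup ι ℂ) (x : ι × κ → ℂ),
      Φ (fun p => ∑ i, (U : Matrix ι ι ℂ) p.1 i * x (i, p.2)) = Φ x) {s : ℝ} (hs : 0 ≤ s) :
    ∫⁻ x, Φ x * ENNReal.ofReal
        (∏ a, (1 + s * gramEig (Matrix.of fun i j => x (i, j)) a))⁻¹ ∂(cGaussPi (ι × κ)) =
      ∫⁻ x, Φ x * ENNReal.ofReal ((1 + s * ∑ j, ‖x (a₀, j)‖ ^ 2) ^ Fintype.card ι)⁻¹
        ∂(cGaussPi (ι × κ)) := by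
  have hpull (F : (ι → ℂ) → (ι × κ → ℂ) → ENNReal) (hF : Measurable fun p : _ × _ => F p.2 p.1) :
      ∫⁻ x, Φ x * ∫⁻ y, F y x ∂(cGaussPi ι) ∂(cGaussPi (ι × κ)) =
        ∫⁻ y, ∫⁻ x, Φ x * F y x ∂(cGaussPi (ι × κ)) ∂(cGaussPi ι) := by
    have hm : Measurable (Function.uncurry fun x y => Φ x * F y x) :=
      (hΦ.comp measurable_fst).mul hF
    rw [← lintegral_lintegral_swap hm.aemeasurable]
    refine lintegral_congr fun x => (lintegral_const_mul _ ?_).symm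
    exact hF.comp measurable_prodMk_left
  let F₁ (y : ι → ℂ) (x : ι × κ → ℂ) : ENNReal := ENNReal.ofReal
    (Real.exp (-(s * ∑ j, ‖∑ i, star (y i) * x (i, j)‖ ^ 2)))
  let F₂ (y : ι → ℂ) (x : ι × κ → ℂ) : ENNReal := ENNReal.ofReal
    (Real.exp (-(s * ((∑ i : ι, ‖y i‖ ^ 2) * ∑ j, ‖x (a₀, j)‖ ^ 2))))
  have hF₂ (y) : Measurable (F₂ y) := by fun_prop
  have hL (x) : ENNReal.ofReal (∏ a, (1 + s * gramEig (Matrix.of fun i j => x (i, j)) a))⁻¹ =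
    ∫⁻ y, F₁ y x ∂(cGaussPi ι) := ofReal_inv_prod_gramEig hs x
  have hR (x : ι × κ → ℂ) : ENNReal.ofReal
      ((1 + s * ∑ j, ‖x (a₀, j)‖ ^ 2) ^ Fintype.card ι)⁻¹ =
    ∫⁻ y, F₂ y x ∂(cGaussPi ι) := ofReal_inv_pow_row a₀ hs x
  simp_rw [hL, hR]
  rw [hpull F₁ (by fun_prop), hpull F₂ (by fun_prop)]
  refine lintegral_congr fun y => ?_
  obtain ⟨U, hU⟩ := exists_unitary_row a₀ y
  rw [← lintegral_cGaussPi_unitary_mul U (fun x => Φ x * F₂ y x) (hΦ.mul (hF₂ y))]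
  refine lintegral_congr fun x => ?_
  have hrow : ∑ j, ‖∑ i, star (y i) * x (i, j)‖ ^ 2 =
      (∑ i, ‖y i‖ ^ 2) * ∑ j, ‖∑ i, (U : Matrix ι ι ℂ) a₀ i * x (i, j)‖ ^ 2 := by
    rw [Finset.mul_sum]
    refine Finset.sum_congr rfl fun j _ => ?_
    simp_rw [hU, mul_assoc]
    rw [← Finset.mul_sum, norm_mul, mul_pow, Complex.norm_real,
      Real.norm_of_nonneg (by positivity), Real.sq_sqrt (by positivity)]
  rw [hinv]
  simp only [F₁, F₂, hrow]

open Polynomial in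
theorem lintegral_coeff_of_lintegral_eval {Ω : Type*} [MeasurableSpace Ω] {μ : Measure Ω}
    {P : Ω → ℝ[X]} {Q : ℝ[X]} {N : ℕ} (hnn : ∀ ω j, 0 ≤ (P ω).coeff j)
    (hm : ∀ j, Measurable fun ω => (P ω).coeff j) (hdeg : ∀ ω, (P ω).natDegree ≤ N)
    (hQ : ∀ t : ℝ, 0 < t → 0 ≤ Q.eval t)
    (hev : ∀ t : ℝ, 0 < t →
      ∫⁻ ω, ENNReal.ofReal ((P ω).eval t) ∂μ = ENNReal.ofReal (Q.eval t)) (j : ℕ) :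
    ∫⁻ ω, ENNReal.ofReal ((P ω).coeff j) ∂μ = ENNReal.ofReal (Q.coeff j) := by
  set a : ℕ → ENNReal := fun j => ∫⁻ ω, ENNReal.ofReal ((P ω).coeff j) ∂μ with ha
  have hsum (t : ℝ) (ht : 0 < t) :
      ∑ j ∈ Finset.range (N + 1), a j * ENNReal.ofReal (t ^ j) = ENNReal.ofReal (Q.eval t) := by
    rw [← hev t ht]
    have h (ω) : ENNReal.ofReal ((P ω).eval t) = ∑ j ∈ Finset.range (N + 1),
        ENNReal.ofReal ((P ω).coeff j) * ENNReal.ofReal (t ^ j) := by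
      rw [eval_eq_sum_range' (Nat.lt_succ_of_le (hdeg ω)),
        ENNReal.ofReal_sum_of_nonneg fun j _ => mul_nonneg (hnn ω j) (by positivity)]
      exact Finset.sum_congr rfl fun j _ => ENNReal.ofReal_mul (hnn ω j)
    simp_rw [h]
    rw [lintegral_finsetSum _ fun j _ => (hm j).ennreal_ofReal.mul_const _]
    exact Finset.sum_congr rfl fun j _ => (lintegral_mul_const _ (hm j).ennreal_ofReal).symm
  have hfin (j) (hj : j ∈ Finset.range (N + 1)) : a j ≠ ⊤ := by
    have h := hsum 1 one_pos
    simp only [one_pow, ENNReal.ofReal_one, mul_one] at h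
    exact ENNReal.sum_ne_top.1 (h ▸ ENNReal.ofReal_ne_top) j hj
  have hpoly : ∑ j ∈ Finset.range (N + 1), C (a j).toReal * X ^ j = Q := by
    refine eq_of_infinite_eval_eq _ _ ((Set.Ioi_infinite (0 : ℝ)).mono fun t ht => ?_)
    have ht : (0 : ℝ) < t := ht
    have h := congrArg ENNReal.toReal (hsum t ht)
    rw [ENNReal.toReal_ofReal (hQ t ht), ENNReal.toReal_sum
      fun j hj => ENNReal.mul_ne_top (hfin j hj) ENNReal.ofReal_ne_top] at h
    rw [Set.mem_ofPred_eq, ← h, eval_finsetSum]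
    refine Finset.sum_congr rfl fun j _ => ?_
    rw [ENNReal.toReal_mul, ENNReal.toReal_ofReal (by positivity)]
    simp
  rw [← hpoly, finsetSum_coeff]
  simp_rw [coeff_C_mul_X_pow]
  rw [Finset.sum_ite_eq]
  split_ifs with hj
  · rw [ENNReal.ofReal_toReal (hfin j hj)]
  · have h (ω) : (P ω).coeff j = 0 :=
      coeff_eq_zero_of_natDegree_lt ((hdeg ω).trans_lt (by simpa using hj))
    simp [h]

theorem det_diagonal_add_vecMulVec {κ : Type*} [Fintype κ] [DecidableEq κ] (d : κ → ℝ)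
    (hd : ∀ k, 0 < d k) (x : κ → ℂ) :
    (diagonal (fun k => (d k : ℂ)) + vecMulVec x (star x)).det =
      ((∏ k, d k + ∑ k, (∏ l ∈ Finset.univ.erase k, d l) * ‖x k‖ ^ 2 : ℝ) : ℂ) := by
  have hd' (k) : (d k : ℂ) ≠ 0 := by exact_mod_cast (hd k).ne'
  have hdet : (diagonal (fun k => (d k : ℂ))).det = ∏ k, (d k : ℂ) := det_diagonal
  have hinv : (diagonal (fun k => (d k : ℂ)))⁻¹ = diagonal fun k => (d k : ℂ)⁻¹ := by
    refine inv_eq_right_inv ?_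
    rw [diagonal_mul_diagonal, ← diagonal_one]
    exact congrArg diagonal (funext fun k => mul_inv_cancel₀ (hd' k))
  rw [vecMulVec_eq Unit, det_add_replicateCol_mul_replicateRow, hdet, hinv, det_unique]
  · simp only [Matrix.add_apply, one_apply_eq, mul_apply, diagonal_apply, replicateRow_apply,
      replicateCol_apply]
    push_cast
    rw [mul_add, mul_one, Finset.mul_sum]
    congr 1
    refine Finset.sum_congr rfl fun k _ => ?_
    rw [← Finset.mul_prod_erase _ _ (Finset.mem_univ k), ← Complex.mul_conj']
    simp only [mul_ite, mul_zero, Finset.sum_ite_eq', Finset.mem_univ, if_true, Pi.star_apply,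
      RCLike.star_def]
    field_simp [hd' k]
  · rw [hdet, isUnit_iff_ne_zero]
    exact Finset.prod_ne_zero_iff.2 fun k _ => hd' k

theorem lintegral_det_add_vecMulVec {κ ι : Type*} [Fintype κ] [DecidableEq κ] [Fintype ι]
    (A : Matrix κ ι ℂ) {t : ℝ} (ht : 0 < t) :
    ∫⁻ x, ENNReal.ofReal (scalar κ (t : ℂ) + (A * Aᴴ + vecMulVec x (star x))).det.re
        ∂(cGaussPi κ) =
      ENNReal.ofReal ((gramPoly A).eval t + (gramPoly A).derivative.eval t) := by
  have hH := isHermitian_mul_conjTranspose_self A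
  set U := hH.eigenvectorUnitary
  have hpos (k) : 0 < t + gramEig A k := add_pos_of_pos_of_nonneg ht (gramEig_nonneg A k)
  have hspec : A * Aᴴ = (U : Matrix κ κ ℂ) * diagonal (fun k => (gramEig A k : ℂ)) *
      star (U : Matrix κ κ ℂ) := by
    have := hH.spectral_theorem
    rw [Unitary.conjStarAlgAut_apply] at this
    exact this
  have hconj (x : κ → ℂ) : (scalar κ (t : ℂ) + (A * Aᴴ +
      vecMulVec ((U : Matrix κ κ ℂ) *ᵥ x) (star ((U : Matrix κ κ ℂ) *ᵥ x)))).det =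
      (diagonal (fun k => ((t + gramEig A k : ℝ) : ℂ)) + vecMulVec x (star x)).det := by
    have h1 : vecMulVec ((U : Matrix κ κ ℂ) *ᵥ x) (star ((U : Matrix κ κ ℂ) *ᵥ x)) =
        (U : Matrix κ κ ℂ) * vecMulVec x (star x) * star (U : Matrix κ κ ℂ) := by
      rw [star_mulVec, mul_vecMulVec, vecMulVec_mul]
      rfl
    have h2 : scalar κ (t : ℂ) = (U : Matrix κ κ ℂ) * scalar κ (t : ℂ) *
        star (U : Matrix κ κ ℂ) := by
      rw [← (scalar_commute (t : ℂ) (fun _ => Commute.all _ _) _).eq, Matrix.mul_assoc,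
        Unitary.mul_star_self_of_mem U.2, Matrix.mul_one]
    rw [h1, hspec, h2, ← Matrix.add_mul, ← Matrix.mul_add, ← Matrix.add_mul, ← Matrix.mul_add,
      det_mul, mul_comm, det_mul, ← mul_assoc, ← det_mul,
      Unitary.star_mul_self_of_mem U.2, det_one, one_mul, ← add_assoc]
    congr 2
    ext i j
    by_cases h : i = j <;> simp [h]
  rw [← lintegral_cGaussPi_unitary_mulVec U]
  · simp_rw [hconj, det_diagonal_add_vecMulVec _ hpos, Complex.ofReal_re]
    have hp (k) : 0 ≤ ∏ l ∈ Finset.univ.erase k, (t + gramEig A l) :=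
      Finset.prod_nonneg fun l _ => (hpos l).le
    have hp' : 0 ≤ ∏ k, (t + gramEig A k) := Finset.prod_nonneg fun l _ => (hpos l).le
    have hs (x : κ → ℂ) : ENNReal.ofReal (∏ k, (t + gramEig A k) +
        ∑ k, (∏ l ∈ Finset.univ.erase k, (t + gramEig A l)) * ‖x k‖ ^ 2) =
        ENNReal.ofReal (∏ k, (t + gramEig A k)) +
        ∑ k, ENNReal.ofReal (∏ l ∈ Finset.univ.erase k, (t + gramEig A l)) *
          ENNReal.ofReal (‖x k‖ ^ 2) := by
      rw [ENNReal.ofReal_add hp' (Finset.sum_nonneg fun k _ => mul_nonneg (hp k) (by positivity)),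
        ENNReal.ofReal_sum_of_nonneg fun k _ => mul_nonneg (hp k) (by positivity)]
      simp_rw [ENNReal.ofReal_mul (hp _)]
    simp_rw [hs]
    rw [lintegral_add_left measurable_const, lintegral_finsetSum _ (by fun_prop)]
    have hk (k : κ) : ∫⁻ x, ENNReal.ofReal (∏ l ∈ Finset.univ.erase k, (t + gramEig A l)) *
          ENNReal.ofReal (‖x k‖ ^ 2) ∂(cGaussPi κ) =
        ENNReal.ofReal (∏ l ∈ Finset.univ.erase k, (t + gramEig A l)) := by
      rw [lintegral_const_mul _ (by fun_prop), lintegral_cGaussPi_apply_sq, mul_one]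
    simp_rw [hk]
    rw [lintegral_const, measure_univ, mul_one,
      ← ENNReal.ofReal_sum_of_nonneg fun k _ => hp k,
      ← ENNReal.ofReal_add hp' (Finset.sum_nonneg fun k _ => hp k), eval_gramPoly, gramPoly,
      Polynomial.derivative_prod_finset, Polynomial.eval_finsetSum]
    congr 2
    refine Finset.sum_congr rfl fun k _ => ?_
    simp [Polynomial.eval_prod]
  · simp_rw [det_apply']
    have hm (i j : κ) : Measurable fun x : κ → ℂ =>
        (scalar κ (t : ℂ) + (A * Aᴴ + vecMulVec x (star x))) i j := by
      simp only [Matrix.add_apply, vecMulVec_apply, Pi.star_apply]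
      fun_prop
    exact (Complex.measurable_re.comp (Finset.measurable_fun_sum _ fun σ _ =>
      (Finset.measurable_fun_prod _ fun i _ => hm _ _).const_mul _)).ennreal_ofReal

/-- The law of a matrix with independent standard complex Gaussian entries, as a family of rows. -/
def cGaussRows (ι κ : Type*) [Fintype ι] [Fintype κ] : Measure (ι → κ → ℂ) :=
  Measure.pi fun _ => cGaussPi κ

instance (ι κ : Type*) [Fintype ι] [Fintype κ] : IsProbabilityMeasure (cGaussRows ι κ) := by
  unfold cGaussRows; infer_instance

theorem lintegral_cGaussPi_prod {ι κ : Type*} [Fintype ι] [Fintype κ]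
    (f : (ι → κ → ℂ) → ENNReal) (hf : Measurable f) :
    ∫⁻ x, f (fun i j => x (i, j)) ∂(cGaussPi (ι × κ)) = ∫⁻ X, f X ∂(cGaussRows ι κ) := by
  have hu : Measurable fun (X : ι → κ → ℂ) (p : ι × κ) => X p.1 p.2 := by fun_prop
  have h : (cGaussRows ι κ).map (fun X p => X p.1 p.2) = cGaussPi (ι × κ) := by
    refine (Measure.pi_eq (μ := fun _ : ι × κ => cGauss) fun s hs => ?_).symm
    rw [Measure.map_apply hu (MeasurableSet.univ_pi hs)]
    have hpre : (fun (X : ι → κ → ℂ) (p : ι × κ) => X p.1 p.2) ⁻¹' Set.univ.pi s =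
        Set.univ.pi fun i => Set.univ.pi fun j => s (i, j) := by
      ext X
      simp [Set.mem_pi]
    rw [hpre, cGaussRows, Measure.pi_pi, Fintype.prod_prod_type]
    refine Finset.prod_congr rfl fun i _ => ?_
    rw [cGaussPi, Measure.pi_pi]
  have hf' : Measurable fun x : ι × κ → ℂ => f fun i j => x (i, j) := hf.comp (by fun_prop)
  rw [← h, lintegral_map hf' hu]

theorem lintegral_cGaussRows_apply {ι κ : Type*} [Fintype ι] [Fintype κ] (i : ι)
    (f : (κ → ℂ) → ENNReal) (hf : Measurable f) :
    ∫⁻ X, f (X i) ∂(cGaussRows ι κ) = ∫⁻ x, f x ∂(cGaussPi κ) :=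
  (measurePreserving_eval (fun _ : ι => cGaussPi κ) i).lintegral_comp hf

theorem lintegral_cGaussRows_cons {κ : Type*} [Fintype κ] {M : ℕ}
    (f : (Fin (M + 1) → κ → ℂ) → ENNReal) (hf : Measurable f) :
    ∫⁻ X, f X ∂(cGaussRows (Fin (M + 1)) κ) =
      ∫⁻ Y, ∫⁻ x, f (Fin.cons x Y) ∂(cGaussPi κ) ∂(cGaussRows (Fin M) κ) := by
  have h := (measurePreserving_piFinSuccAbove (fun _ : Fin (M + 1) => cGaussPi κ) 0).symm
  have hm : Measurable fun a =>
      f ((MeasurableEquiv.piFinSuccAbove (fun _ : Fin (M + 1) => κ → ℂ) 0).symm a) :=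
    hf.comp (MeasurableEquiv.measurable _)
  rw [cGaussRows, ← h.lintegral_comp hf, lintegral_prod_symm _ hm.aemeasurable]
  refine lintegral_congr fun Y => lintegral_congr fun x => congrArg f ?_
  exact Fin.insertNth_zero' x Y

theorem measurable_gramPoly_transpose_coeff (ι κ : Type*) [Fintype ι] [Fintype κ] [DecidableEq κ]
    (j : ℕ) : Measurable fun X : ι → κ → ℂ => (gramPoly (Matrix.of X)ᵀ).coeff j :=
  measurable_gramPoly_coeff (fun k i => by simp only [transpose_apply, of_apply]; fun_prop) j

theorem lintegral_gramPoly_cons_coeff {κ : Type*} [Fintype κ] [DecidableEq κ] {M : ℕ}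
    (Y : Fin M → κ → ℂ) (j : ℕ) :
    ∫⁻ x, ENNReal.ofReal ((gramPoly (Matrix.of (Fin.cons x Y : Fin (M + 1) → κ → ℂ))ᵀ).coeff j)
        ∂(cGaussPi κ) =
      ENNReal.ofReal ((gramPoly (Matrix.of Y)ᵀ).coeff j +
        (gramPoly (Matrix.of Y)ᵀ).coeff (j + 1) * (j + 1)) := by
  have hnn (k : ℕ) :
      0 ≤ (gramPoly (Matrix.of Y)ᵀ + (gramPoly (Matrix.of Y)ᵀ).derivative).coeff k := by
    rw [Polynomial.coeff_add, Polynomial.coeff_derivative]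
    have := gramPoly_coeff_nonneg (Matrix.of Y)ᵀ
    exact add_nonneg (this _) (mul_nonneg (this _) (by positivity))
  have h := lintegral_coeff_of_lintegral_eval (μ := cGaussPi κ)
    (P := fun x => gramPoly (Matrix.of (Fin.cons x Y : Fin (M + 1) → κ → ℂ))ᵀ)
    (Q := gramPoly (Matrix.of Y)ᵀ + (gramPoly (Matrix.of Y)ᵀ).derivative)
    (N := Fintype.card κ) (fun x j => gramPoly_coeff_nonneg _ j) (fun j =>
      (measurable_gramPoly_transpose_coeff _ _ j).comp (by fun_prop))
    (fun x => (gramPoly_natDegree _).le)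
    (fun t ht => by
      rw [Polynomial.eval_eq_sum_range]
      exact Finset.sum_nonneg fun k _ => mul_nonneg (hnn k) (by positivity))
    (fun t ht => by
      rw [Polynomial.eval_add, ← lintegral_det_add_vecMulVec _ ht]
      refine lintegral_congr fun x => congrArg _ ?_
      rw [← Complex.ofReal_re (Polynomial.eval t _), ofReal_eval_gramPoly]
      congr 3
      ext k l
      simp [mul_apply, Fin.sum_univ_succ, vecMulVec_apply, add_comm]) j
  rw [h, Polynomial.coeff_add, Polynomial.coeff_derivative]

/-- The conditional expectation, given that one of the rows has squared norm `q`, of the `i`-th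
elementary symmetric function of the squared singular values of an `(M + 1) × n` Gaussian
matrix. -/
def rowMoment (n M : ℕ) : ℕ → ℝ → ℝ
  | 0, _ => 1
  | i + 1, q => (n - 1).descFactorial i * (M.choose i * q + M.choose (i + 1) * n)

theorem rowMoment_nonneg (n M i : ℕ) {q : ℝ} (hq : 0 ≤ q) : 0 ≤ rowMoment n M i q := by
  cases i <;> simp only [rowMoment] <;> positivity

theorem measurable_rowMoment (n M i : ℕ) : Measurable (rowMoment n M i) := by
  cases i <;> unfold rowMoment <;> fun_prop

theorem rowMoment_succ (n M i : ℕ) (hi : i + 1 ≤ n) (q : ℝ) :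
    rowMoment n (M + 1) (i + 1) q =
      rowMoment n M (i + 1) q + rowMoment n M i q * (n - i) := by
  rcases i with _ | i
  · simp [rowMoment]
    ring
  · have h : ((n - 1 - i : ℕ) : ℝ) = n - (i + 1) := by
      rw [Nat.sub_sub, Nat.cast_sub (by omega)]
      push_cast
      ring
    simp only [rowMoment, Nat.choose_succ_succ, Nat.descFactorial_succ]
    push_cast
    rw [h]
    ring

theorem lintegral_gramPoly_coeff_mul {κ : Type*} [Fintype κ] [DecidableEq κ] {N : ℕ}
    (hN : Fintype.card κ = N + 1) (φ : ℝ → ENNReal) (hφ : Measurable φ) (M i : ℕ)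
    (hi : i ≤ N + 1) :
    ∫⁻ X, ENNReal.ofReal ((gramPoly (Matrix.of X)ᵀ).coeff (N + 1 - i)) *
        φ (∑ j, ‖X (Fin.last M) j‖ ^ 2) ∂(cGaussRows (Fin (M + 1)) κ) =
      ∫⁻ q, ENNReal.ofReal (rowMoment (N + 1) M i q) * φ q ∂(gammaLaw N) := by
  have hrow (M : ℕ) (ψ : ℝ → ENNReal) (hψ : Measurable ψ) :
      ∫⁻ X, ψ (∑ j, ‖X (Fin.last M) j‖ ^ 2) ∂(cGaussRows (Fin (M + 1)) κ) =
        ∫⁻ q, ψ q ∂(gammaLaw N) := by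
    rw [← lintegral_cGaussPi_norm_sq hN ψ hψ]
    exact lintegral_cGaussRows_apply (Fin.last M) (fun x => ψ (∑ j, ‖x j‖ ^ 2)) (by fun_prop)
  induction M generalizing i with
  | zero =>
    have hmeas := measurable_rowMoment (N + 1) 0 i
    rw [← hrow 0 _ (by fun_prop)]
    refine lintegral_congr fun X => congrArg (fun r => ENNReal.ofReal r * _) ?_
    rw [gramPoly_transpose _ (by simp [hN]), Polynomial.coeff_X_pow_mul', hN]
    have h1 := gramPoly_coeff_card (Matrix.of X)
    have h0 := gramPoly_coeff_card_sub_one (Matrix.of X) (k := 0) (by simp)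
    simp only [Fintype.card_fin] at h1 ⊢
    rcases i with _ | _ | i
    · simpa [rowMoment] using h1
    · simpa [rowMoment] using h0
    · rw [if_neg (by omega)]
      simp [rowMoment]
  | succ M ih =>
    rcases i with _ | i
    · rw [← hrow _ _ (by unfold rowMoment; fun_prop)]
      refine lintegral_congr fun X => congrArg (fun r => ENNReal.ofReal r * _) ?_
      rw [Nat.sub_zero, ← hN, gramPoly_coeff_card, rowMoment]
    · have hm (j : ℕ) := measurable_gramPoly_transpose_coeff (Fin (M + 1)) κ j
      have hm' (j : ℕ) := measurable_gramPoly_transpose_coeff (Fin (M + 1 + 1)) κ j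
      have hmr (i : ℕ) := measurable_rowMoment (N + 1) M i
      have hlast (x : κ → ℂ) (Y : Fin (M + 1) → κ → ℂ) :
        (Fin.cons x Y : Fin (M + 1 + 1) → κ → ℂ) (Fin.last (M + 1)) = Y (Fin.last M) := rfl
      have hj : ((N + 1 - (i + 1) : ℕ) : ℝ) + 1 = (N + 1 : ℕ) - i := by
        rw [Nat.cast_sub hi]
        push_cast
        ring
      have hni : (0 : ℝ) ≤ (N + 1 : ℕ) - i := by
        rw [← hj]; positivity
      rw [lintegral_cGaussRows_cons _ (by fun_prop)]
      have hin (Y : Fin (M + 1) → κ → ℂ) : ∫⁻ x, ENNReal.ofReal ((gramPoly (Matrix.of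
            (Fin.cons x Y : Fin (M + 1 + 1) → κ → ℂ))ᵀ).coeff (N + 1 - (i + 1))) *
            φ (∑ j, ‖(Fin.cons x Y : Fin (M + 1 + 1) → κ → ℂ) (Fin.last (M + 1)) j‖ ^ 2)
              ∂(cGaussPi κ) =
          ENNReal.ofReal ((gramPoly (Matrix.of Y)ᵀ).coeff (N + 1 - (i + 1))) *
            φ (∑ j, ‖Y (Fin.last M) j‖ ^ 2) + ENNReal.ofReal ((N + 1 : ℕ) - i) *
          (ENNReal.ofReal ((gramPoly (Matrix.of Y)ᵀ).coeff (N + 1 - i)) *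
            φ (∑ j, ‖Y (Fin.last M) j‖ ^ 2)) := by
        have hmx : Measurable fun x : κ → ℂ => (gramPoly (Matrix.of
            (Fin.cons x Y : Fin (M + 1 + 1) → κ → ℂ))ᵀ).coeff (N + 1 - (i + 1)) :=
          (hm' _).comp (by fun_prop)
        simp_rw [hlast]
        rw [lintegral_mul_const _ hmx.ennreal_ofReal,
          lintegral_gramPoly_cons_coeff, show N + 1 - (i + 1) + 1 = N + 1 - i by omega, hj,
          ENNReal.ofReal_add (gramPoly_coeff_nonneg _ _)
            (mul_nonneg (gramPoly_coeff_nonneg _ _) hni),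
          ENNReal.ofReal_mul (gramPoly_coeff_nonneg _ _)]
        ring
      simp_rw [hin]
      rw [lintegral_add_left (by fun_prop), lintegral_const_mul _ (by fun_prop), ih _ hi,
        ih _ (by omega), ← lintegral_const_mul _ (by fun_prop), ← lintegral_add_left (by fun_prop),
        lintegral_gammaLaw, lintegral_gammaLaw]
      refine setLIntegral_congr_fun measurableSet_Ioi fun q hq => ?_
      have hq : (0 : ℝ) ≤ q := le_of_lt hq
      rw [rowMoment_succ _ _ _ hi, ENNReal.ofReal_add (rowMoment_nonneg _ _ _ hq)
        (mul_nonneg (rowMoment_nonneg _ _ _ hq) hni),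
        ENNReal.ofReal_mul (rowMoment_nonneg _ _ _ hq)]
      ring

theorem abs_log_le_rpow_add_rpow {q : ℝ} (hq : 0 < q) :
    |Real.log q| ≤ 2 * (q ^ (1 / 2 : ℝ) + q ^ (-1 / 2 : ℝ)) := by
  have h1 := Real.log_le_rpow_div hq.le (ε := 1 / 2) (by norm_num)
  have h2 := Real.log_le_rpow_div (inv_nonneg.2 hq.le) (ε := 1 / 2) (by norm_num)
  rw [Real.log_inv, Real.inv_rpow hq.le, ← Real.rpow_neg hq.le,
    show (-(1 / 2) : ℝ) = -1 / 2 by norm_num] at h2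
  have h3 := Real.rpow_pos_of_pos hq (1 / 2)
  have h4 := Real.rpow_pos_of_pos hq (-1 / 2)
  rw [abs_le]
  constructor <;> linarith

theorem integrableOn_pow_mul_exp_neg_mul_log (k : ℕ) :
    IntegrableOn (fun q : ℝ => q ^ k * Real.exp (-q) * Real.log q) (Set.Ioi 0) := by
  have h1 := Real.GammaIntegral_convergent (s := k + 3 / 2) (by positivity)
  have h2 := Real.GammaIntegral_convergent (s := k + 1 / 2) (by positivity)
  refine ((h1.add h2).const_mul 2).mono' (by fun_prop) ?_
  filter_upwards [ae_restrict_mem measurableSet_Ioi] with q hq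
  have hq : (0 : ℝ) < q := hq
  have e1 : q ^ ((k : ℝ) + 3 / 2 - 1) = q ^ k * q ^ (1 / 2 : ℝ) := by
    rw [← Real.rpow_natCast, ← Real.rpow_add hq]
    ring_nf
  have e2 : q ^ ((k : ℝ) + 1 / 2 - 1) = q ^ k * q ^ (-1 / 2 : ℝ) := by
    rw [← Real.rpow_natCast, ← Real.rpow_add hq]
    ring_nf
  rw [Real.norm_eq_abs, abs_mul, abs_of_pos (by positivity)]
  simp only [Pi.add_apply]
  rw [e1, e2]
  refine (mul_le_mul_of_nonneg_left (abs_log_le_rpow_add_rpow hq) (by positivity)).trans_eq ?_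
  ring

theorem integral_pow_mul_exp_neg_mul_log_succ (k : ℕ) :
    ∫ q in Set.Ioi (0 : ℝ), q ^ (k + 1) * Real.exp (-q) * Real.log q =
      (k + 1) * (∫ q in Set.Ioi (0 : ℝ), q ^ k * Real.exp (-q) * Real.log q) + k.factorial := by
  have i0 := integrableOn_pow_mul_exp_neg k
  have i1 := integrableOn_pow_mul_exp_neg_mul_log k
  have i2 := integrableOn_pow_mul_exp_neg_mul_log (k + 1)
  have hcont : Continuous fun q : ℝ => q ^ k * Real.exp (-q) * (q * Real.log q) := by
    have := Real.continuous_mul_log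
    fun_prop
  have hder : ∀ q ∈ Set.Ioi (0 : ℝ), HasDerivAt
      (fun q : ℝ => q ^ k * Real.exp (-q) * (q * Real.log q))
      ((k + 1) * (q ^ k * Real.exp (-q) * Real.log q) + q ^ k * Real.exp (-q) -
        q ^ (k + 1) * Real.exp (-q) * Real.log q) q := by
    intro q hq
    have hq : (0 : ℝ) < q := hq
    have h := (((hasDerivAt_pow (k + 1) q).mul (hasDerivAt_neg q).exp).mul
      (Real.hasDerivAt_log hq.ne'))
    refine (h.congr_deriv ?_).congr_of_eventuallyEq (Filter.Eventually.of_forall fun x => ?_)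
    · simp only [Nat.add_sub_cancel, Pi.mul_apply]
      push_cast
      field_simp
      ring
    · simp only [Pi.mul_apply]
      ring
  have i3 : IntegrableOn (fun q : ℝ =>
      (k + 1) * (q ^ k * Real.exp (-q) * Real.log q) + q ^ k * Real.exp (-q)) (Set.Ioi 0) :=
    (i1.const_mul _).add i0
  have hlim : Filter.Tendsto (fun q : ℝ => q ^ k * Real.exp (-q) * (q * Real.log q))
      Filter.atTop (nhds 0) := by
    have h := Real.tendsto_pow_mul_exp_neg_atTop_nhds_zero (k + 2)
    refine squeeze_zero' ?_ ?_ h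
    · filter_upwards [Filter.eventually_ge_atTop 1] with q hq
      have := Real.log_nonneg hq
      positivity
    · filter_upwards [Filter.eventually_ge_atTop 1] with q hq
      have h1 := Real.log_le_self (zero_le_one.trans hq)
      have h0 : (0 : ℝ) ≤ q := zero_le_one.trans hq
      calc q ^ k * Real.exp (-q) * (q * Real.log q) ≤ q ^ k * Real.exp (-q) * (q * q) := by gcongr
        _ = q ^ (k + 2) * Real.exp (-q) := by ring
  have h := integral_Ioi_of_hasDerivAt_of_tendsto hcont.continuousWithinAt hder (i3.sub i2) hlim
  rw [integral_sub i3 i2, integral_add (i1.const_mul _) i0,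
    integral_const_mul, integral_pow_mul_exp_neg] at h
  simp only [zero_mul, mul_zero, sub_zero] at h
  linarith

theorem integral_pow_mul_exp_neg_mul_log (k : ℕ) :
    ∫ q in Set.Ioi (0 : ℝ), q ^ k * Real.exp (-q) * Real.log q =
      k.factorial * ((∫ q in Set.Ioi (0 : ℝ), q ^ 0 * Real.exp (-q) * Real.log q) +
        ∑ j ∈ Finset.Icc 1 k, (1 : ℝ) / j) := by
  induction k with
  | zero => simp
  | succ k ih =>
    rw [integral_pow_mul_exp_neg_mul_log_succ, ih, Finset.sum_Icc_succ_top (by omega),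
      Nat.factorial_succ]
    push_cast
    field_simp
    ring

theorem integrable_gammaLaw {k : ℕ} {f : ℝ → ℝ}
    (hf : IntegrableOn (fun q => q ^ k * Real.exp (-q) * f q) (Set.Ioi 0)) :
    Integrable f (gammaLaw k) := by
  rw [gammaLaw, integrable_withDensity_iff_integrable_smul' (by fun_prop)
    (Filter.Eventually.of_forall fun q => ENNReal.ofReal_lt_top)]
  refine (hf.div_const (k.factorial : ℝ)).congr ?_
  filter_upwards [ae_restrict_mem measurableSet_Ioi] with q hq
  have hq : (0 : ℝ) < q := hq
  rw [ENNReal.toReal_ofReal (by positivity), smul_eq_mul]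
  ring

theorem integral_gammaLaw (k : ℕ) (f : ℝ → ℝ) :
    ∫ q, f q ∂(gammaLaw k) =
      (∫ q in Set.Ioi (0 : ℝ), q ^ k * Real.exp (-q) * f q) / k.factorial := by
  rw [gammaLaw, integral_withDensity_eq_integral_toReal_smul (by fun_prop)
    (Filter.Eventually.of_forall fun q => ENNReal.ofReal_lt_top), ← integral_div]
  refine setIntegral_congr_fun measurableSet_Ioi fun q hq => ?_
  have hq : (0 : ℝ) < q := hq
  rw [ENNReal.toReal_ofReal (by positivity), smul_eq_mul]
  ring

theorem integrable_gammaLaw_log (k : ℕ) : Integrable Real.log (gammaLaw k) :=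
  integrable_gammaLaw (integrableOn_pow_mul_exp_neg_mul_log k)

theorem integrable_gammaLaw_mul_log (k : ℕ) :
    Integrable (fun q => q * Real.log q) (gammaLaw k) := by
  refine integrable_gammaLaw ((integrableOn_pow_mul_exp_neg_mul_log (k + 1)).congr_fun
    (fun q _ => ?_) measurableSet_Ioi)
  ring

theorem integral_gammaLaw_mul_log (k : ℕ) :
    ∫ q, q * Real.log q ∂(gammaLaw k) = (k + 1) * ∫ q, Real.log q ∂(gammaLaw (k + 1)) := by
  rw [integral_gammaLaw, integral_gammaLaw, Nat.factorial_succ]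
  simp_rw [← mul_assoc]
  have : ∀ q : ℝ, q ^ k * Real.exp (-q) * q = q ^ (k + 1) * Real.exp (-q) := fun q => by ring
  simp_rw [this]
  push_cast
  field_simp

theorem integral_gammaLaw_log (k : ℕ) :
    ∫ q, Real.log q ∂(gammaLaw k) =
      (∫ q, Real.log q ∂(gammaLaw 0)) + ∑ j ∈ Finset.Icc 1 k, (1 : ℝ) / j := by
  rw [integral_gammaLaw, integral_gammaLaw, integral_pow_mul_exp_neg_mul_log]
  have : (k.factorial : ℝ) ≠ 0 := by positivity
  field_simp
  simp

/-- If the image of `c • μ` under `q` is `ρ • ν`, then integrals transfer. -/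
theorem integrable_and_integral_of_lintegral_eq {Ω : Type*} [MeasurableSpace Ω] {μ : Measure Ω}
    {ν : Measure ℝ} {c q : Ω → ℝ} (hc : Measurable c) (hq : Measurable q) (hc0 : ∀ x, 0 ≤ c x)
    {ρ : ℝ → ℝ} (hρ : ∀ᵐ y ∂ν, 0 ≤ ρ y)
    (h : ∀ φ : ℝ → ENNReal, Measurable φ →
      ∫⁻ x, ENNReal.ofReal (c x) * φ (q x) ∂μ = ∫⁻ y, ENNReal.ofReal (ρ y) * φ y ∂ν)
    {g : ℝ → ℝ} (hg : Measurable g) (hi : Integrable (fun y => ρ y * g y) ν) :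
    Integrable (fun x => c x * g (q x)) μ ∧ ∫ x, c x * g (q x) ∂μ = ∫ y, ρ y * g y ∂ν := by
  have key (g : ℝ → ℝ) (hg : Measurable g) :
      ∫⁻ x, ENNReal.ofReal (c x * g (q x)) ∂μ = ∫⁻ y, ENNReal.ofReal (ρ y * g y) ∂ν := by
    simp_rw [fun x => ENNReal.ofReal_mul (q := g (q x)) (hc0 x)]
    rw [h _ hg.ennreal_ofReal]
    refine lintegral_congr_ae ?_
    filter_upwards [hρ] with y hy
    rw [ENNReal.ofReal_mul hy]
  have hint : Integrable (fun x => c x * g (q x)) μ := by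
    refine ⟨by fun_prop, ?_⟩
    have habs : ∫⁻ x, ‖c x * g (q x)‖ₑ ∂μ = ∫⁻ y, ‖ρ y * g y‖ₑ ∂ν := by
      have := key (fun y => |g y|) (by fun_prop)
      calc ∫⁻ x, ‖c x * g (q x)‖ₑ ∂μ = ∫⁻ x, ENNReal.ofReal (c x * |g (q x)|) ∂μ := by
            refine lintegral_congr fun x => ?_
            rw [Real.enorm_eq_ofReal_abs, abs_mul, abs_of_nonneg (hc0 x)]
        _ = _ := this
        _ = _ := by
            refine lintegral_congr_ae ?_
            filter_upwards [hρ] with y hy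
            rw [Real.enorm_eq_ofReal_abs, abs_mul, abs_of_nonneg hy]
    rw [hasFiniteIntegral_iff_enorm, habs]
    exact hi.2
  refine ⟨hint, ?_⟩
  have hneg := key (fun y => -g y) hg.neg
  simp_rw [mul_neg] at hneg
  rw [integral_eq_lintegral_pos_part_sub_lintegral_neg_part hint,
    integral_eq_lintegral_pos_part_sub_lintegral_neg_part hi, key g hg, hneg]

theorem ae_gammaLaw_pos (k : ℕ) : ∀ᵐ q ∂(gammaLaw k), 0 < q :=
  (withDensity_absolutelyContinuous _ _).ae_le (ae_restrict_mem measurableSet_Ioi)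

theorem lintegral_cGaussRows_norm_sq {ι κ : Type*} [Fintype ι] [Fintype κ] {k : ℕ}
    (hk : Fintype.card ι * Fintype.card κ = k + 1) (φ : ℝ → ENNReal) (hφ : Measurable φ) :
    ∫⁻ X, φ (∑ i, ∑ j, ‖X i j‖ ^ 2) ∂(cGaussRows ι κ) = ∫⁻ q, φ q ∂(gammaLaw k) := by
  rw [← lintegral_cGaussPi_norm_sq (ι := ι × κ) (by simpa using hk) φ hφ,
    ← lintegral_cGaussPi_prod (fun X => φ (∑ i, ∑ j, ‖X i j‖ ^ 2)) (by fun_prop)]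
  simp_rw [Fintype.sum_prod_type]

theorem gramPoly_transpose_coeff_card_sub_one {ι κ : Type*} [Fintype ι] [Fintype κ]
    [DecidableEq κ] {N : ℕ} (hN : Fintype.card κ = N + 1) (X : ι → κ → ℂ) :
    (gramPoly (Matrix.of X)ᵀ).coeff N = ∑ i, ∑ j, ‖X i j‖ ^ 2 := by
  rw [gramPoly_coeff_card_sub_one _ hN, Finset.sum_comm]
  rfl

theorem sum_norm_sq_le {κ : Type*} [Fintype κ] {M : ℕ} (X : Fin (M + 1) → κ → ℂ) :
    ∑ j, ‖X (Fin.last M) j‖ ^ 2 ≤ ∑ i, ∑ j, ‖X i j‖ ^ 2 :=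
  Finset.single_le_sum (f := fun i => ∑ j, ‖X i j‖ ^ 2) (fun i _ => by positivity)
    (Finset.mem_univ _)

theorem ae_cGaussRows_last_pos {κ : Type*} [Fintype κ] {M N : ℕ} (hN : Fintype.card κ = N + 1) :
    ∀ᵐ X ∂(cGaussRows (Fin (M + 1)) κ), 0 < ∑ j, ‖X (Fin.last M) j‖ ^ 2 := by
  have hm : MeasurableSet (Set.Iic (0 : ℝ)) := measurableSet_Iic
  have h0 : gammaLaw N (Set.Iic 0) = 0 :=
    measure_mono_null (fun q hq => not_lt.2 hq) (ae_iff.1 (ae_gammaLaw_pos N))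
  have hf : Measurable fun x : κ → ℂ => (Set.Iic (0 : ℝ)).indicator (1 : ℝ → ENNReal)
    (∑ j, ‖x j‖ ^ 2) := (measurable_one.indicator hm).comp (by fun_prop)
  have hF : Measurable fun X : Fin (M + 1) → κ → ℂ => (Set.Iic (0 : ℝ)).indicator
    (1 : ℝ → ENNReal) (∑ j, ‖X (Fin.last M) j‖ ^ 2) := hf.comp (measurable_pi_apply _)
  have h := lintegral_cGaussRows_apply (Fin.last M) _ hf
  rw [lintegral_cGaussPi_norm_sq hN _ (measurable_one.indicator hm), lintegral_indicator_one hm,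
    h0, lintegral_eq_zero_iff hF] at h
  filter_upwards [h] with X hX
  by_contra hneg
  simp [not_lt.1 hneg] at hX

theorem lintegral_mul_log_div {κ : Type*} [Fintype κ] {M N k : ℕ}
    (hN : Fintype.card κ = N + 1) (hk : (M + 1) * (N + 1) = k + 1) :
    ∫⁻ X, ENNReal.ofReal ((∑ i, ∑ j, ‖X i j‖ ^ 2) *
        Real.log ((∑ i, ∑ j, ‖X i j‖ ^ 2) / ∑ j, ‖X (Fin.last M) j‖ ^ 2))
          ∂(cGaussRows (Fin (M + 1)) κ) =
      ENNReal.ofReal ((k + 1) * (∑ j ∈ Finset.Icc (N + 2) (k + 1), (1 : ℝ) / j) + M) := by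
  classical
  set μ := cGaussRows (Fin (M + 1)) κ
  set c : (Fin (M + 1) → κ → ℂ) → ℝ := fun X => ∑ i, ∑ j, ‖X i j‖ ^ 2 with hc
  set q : (Fin (M + 1) → κ → ℂ) → ℝ := fun X => ∑ j, ‖X (Fin.last M) j‖ ^ 2 with hq
  have hcm : Measurable c := by fun_prop
  have hqm : Measurable q := by fun_prop
  have hc0 (X) : 0 ≤ c X := by positivity
  have hqc (X) : q X ≤ c X := sum_norm_sq_le X
  obtain ⟨i1, e1⟩ := integrable_and_integral_of_lintegral_eq (μ := μ) (ν := gammaLaw k)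
    (ρ := fun y => y) hcm hcm hc0 ((ae_gammaLaw_pos k).mono fun y hy => hy.le)
    (fun φ hφ => lintegral_cGaussRows_norm_sq (by simpa [hN] using hk)
      (fun y => ENNReal.ofReal y * φ y) (by fun_prop))
    Real.measurable_log (integrable_gammaLaw_mul_log k)
  have hρ (y : ℝ) : rowMoment (N + 1) M 1 y * Real.log y =
      y * Real.log y + (M * (N + 1)) * Real.log y := by
    simp [rowMoment]
    ring
  have i3 := (integrable_gammaLaw_log N).const_mul ((M : ℝ) * (N + 1))
  obtain ⟨i2, e2⟩ := integrable_and_integral_of_lintegral_eq (μ := μ) (ν := gammaLaw N)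
    (ρ := rowMoment (N + 1) M 1) hcm hqm hc0
    ((ae_gammaLaw_pos N).mono fun y hy => rowMoment_nonneg _ _ _ hy.le)
    (fun φ hφ => by
      rw [← lintegral_gramPoly_coeff_mul hN φ hφ M 1 (by omega)]
      simp_rw [Nat.add_sub_cancel, gramPoly_transpose_coeff_card_sub_one hN]
      rfl)
    Real.measurable_log (by
      simp_rw [hρ]
      exact (integrable_gammaLaw_mul_log N).add i3)
  have hae : ∀ᵐ X ∂μ, c X * Real.log (c X / q X) =
      c X * Real.log (c X) - c X * Real.log (q X) := by
    filter_upwards [ae_cGaussRows_last_pos hN] with X hX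
    rw [Real.log_div (hX.trans_le (hqc X)).ne' (ne_of_gt hX), mul_sub]
  have hnn : ∀ᵐ X ∂μ, 0 ≤ c X * Real.log (c X / q X) := by
    filter_upwards [ae_cGaussRows_last_pos hN] with X hX
    exact mul_nonneg (hc0 X) (Real.log_nonneg ((one_le_div hX).2 (hqc X)))
  have hint : Integrable (fun X => c X * Real.log (c X / q X)) μ :=
    (i1.sub i2).congr (hae.mono fun X hX => hX.symm)
  change ∫⁻ X, ENNReal.ofReal (c X * Real.log (c X / q X)) ∂μ = _
  rw [← ofReal_integral_eq_lintegral_ofReal hint hnn, integral_congr_ae hae, integral_sub i1 i2,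
    e1, e2]
  simp_rw [hρ]
  rw [integral_add (integrable_gammaLaw_mul_log N) i3, integral_const_mul,
    integral_gammaLaw_mul_log, integral_gammaLaw_mul_log, integral_gammaLaw_log (k + 1),
    integral_gammaLaw_log (N + 1), integral_gammaLaw_log N,
    Finset.sum_Icc_succ_top (b := N) (by omega)]
  have hsum : ∑ j ∈ Finset.Icc 1 (k + 1), (1 : ℝ) / j =
      ∑ j ∈ Finset.Icc 1 N, (1 : ℝ) / j + 1 / ((N + 1 : ℕ) : ℝ) +
        ∑ j ∈ Finset.Icc (N + 2) (k + 1), (1 : ℝ) / j := by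
    rw [← Finset.sum_Icc_succ_top (by omega)]
    have := Finset.sum_Ioc_consecutive (fun j : ℕ => (1 : ℝ) / j) (Nat.zero_le (N + 1))
      (show N + 1 ≤ k + 1 by nlinarith)
    simp only [← Finset.Icc_add_one_left_eq_Ioc, zero_add] at this
    exact this.symm
  have hk' : ((M : ℝ) + 1) * (N + 1) = k + 1 := by exact_mod_cast hk
  rw [hsum]
  congr 1
  rw [← hk']
  push_cast
  field_simp
  ring

theorem lintegral_Ioi_ofReal_deriv {F f : ℝ → ℝ} {L : ℝ} (hc : ContinuousWithinAt F (Set.Ici 0) 0)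
    (hd : ∀ t ∈ Set.Ioi (0 : ℝ), HasDerivAt F (f t) t) (hf : ∀ t ∈ Set.Ioi (0 : ℝ), 0 ≤ f t)
    (hL : Filter.Tendsto F Filter.atTop (nhds L)) :
    ∫⁻ t in Set.Ioi (0 : ℝ), ENNReal.ofReal (f t) = ENNReal.ofReal (L - F 0) := by
  rw [← integral_Ioi_of_hasDerivAt_of_nonneg hc hd hf hL, ofReal_integral_eq_lintegral_ofReal
    (integrableOn_Ioi_deriv_of_nonneg hc hd hf hL)]
  filter_upwards [ae_restrict_mem measurableSet_Ioi] with t ht using hf t ht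

theorem tendsto_log_add_sub_log (x : ℝ) :
    Filter.Tendsto (fun t => Real.log (x + t) - Real.log t) Filter.atTop (nhds 0) := by
  simp_rw [add_comm x]
  exact Real.tendsto_log_comp_add_sub_log x

theorem lintegral_Ioi_sum_div {ι : Type*} (s : Finset ι) (w x : ι → ℝ) (hw : ∑ a ∈ s, w a = 0)
    (hx : ∀ a ∈ s, 0 ≤ x a) (hwx : ∀ a ∈ s, x a = 0 → w a = 0)
    (hnn : ∀ t, 0 < t → 0 ≤ ∑ a ∈ s, w a / (x a + t)) :
    ∫⁻ t in Set.Ioi (0 : ℝ), ENNReal.ofReal (∑ a ∈ s, w a / (x a + t)) =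
      ENNReal.ofReal (-∑ a ∈ s, w a * Real.log (x a)) := by
  have hc : ContinuousWithinAt (fun t => ∑ a ∈ s, w a * Real.log (x a + t)) (Set.Ici 0) 0 := by
    refine ContinuousAt.continuousWithinAt (tendsto_finsetSum _ fun a ha => ?_)
    rcases eq_or_ne (x a) 0 with h | h
    · simp [hwx a ha h]
    · have : ContinuousAt (fun t => w a * Real.log (x a + t)) 0 := by
        have : x a + 0 ≠ 0 := by simpa using h
        fun_prop (disch := assumption)
      exact this
  have hd : ∀ t ∈ Set.Ioi (0 : ℝ), HasDerivAt (fun t => ∑ a ∈ s, w a * Real.log (x a + t))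
      (∑ a ∈ s, w a / (x a + t)) t := by
    intro t ht
    refine HasDerivAt.fun_sum fun a ha => ?_
    have h : x a + t ≠ 0 := (add_pos_of_nonneg_of_pos (hx a ha) ht).ne'
    have := (((hasDerivAt_id t).const_add (x a)).log h).const_mul (w a)
    simpa [div_eq_mul_inv] using this
  have hL : Filter.Tendsto (fun t => ∑ a ∈ s, w a * Real.log (x a + t)) Filter.atTop
      (nhds 0) := by
    have h : Filter.Tendsto (fun t => ∑ a ∈ s, w a * (Real.log (x a + t) - Real.log t))
        Filter.atTop (nhds (∑ a ∈ s, w a * 0)) :=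
      tendsto_finsetSum _ fun a _ => (tendsto_log_add_sub_log (x a)).const_mul (w a)
    simpa [mul_sub, Finset.sum_sub_distrib, ← Finset.sum_mul, hw] using h
  rw [lintegral_Ioi_ofReal_deriv hc hd hnn hL]
  simp

theorem exists_antideriv_pow_div {q : ℝ} (hq : 0 < q) (a b : ℕ) :
    ∃ F : ℝ → ℝ, F 0 = 0 ∧
      (∀ t, 0 ≤ t → HasDerivAt F (t ^ a / (t + q) ^ (a + b + 2)) t) ∧
      Filter.Tendsto F Filter.atTop
        (nhds ((q ^ (b + 1))⁻¹ * (a.factorial * b.factorial / (a + b + 1).factorial))) := by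
  have hd (k : ℕ) {t : ℝ} (ht : 0 ≤ t) :
      HasDerivAt (fun t => ((t + q) ^ k)⁻¹) (-(k / (t + q) ^ (k + 1))) t := by
    have h0 : t + q ≠ 0 := by positivity
    have h := (((hasDerivAt_id t).add_const q).pow k).inv (pow_ne_zero k h0)
    refine h.congr_deriv ?_
    rcases k with _ | k
    · simp
    · simp only [id, Pi.pow_apply]
      field_simp
      push_cast
      ring
  have ht : Filter.Tendsto (fun t : ℝ => (t + q)⁻¹) Filter.atTop (nhds 0) :=
    (Filter.tendsto_atTop_add_const_right _ q Filter.tendsto_id).inv_tendsto_atTop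
  induction a with
  | zero =>
    refine ⟨fun t => ((q ^ (b + 1))⁻¹ - ((t + q) ^ (b + 1))⁻¹) / (b + 1), by simp, ?_, ?_⟩
    · intro t ht
      refine (((hd (b + 1) ht).const_sub _).div_const _).congr_deriv ?_
      have : t + q ≠ 0 := by positivity
      rw [show 0 + b + 2 = b + 1 + 1 by omega]
      push_cast
      field_simp
    · have h : Filter.Tendsto (fun t => ((q ^ (b + 1))⁻¹ - ((t + q)⁻¹) ^ (b + 1)) / ((b : ℝ) + 1))
          Filter.atTop (nhds (((q ^ (b + 1))⁻¹ - 0 ^ (b + 1)) / ((b : ℝ) + 1))) :=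
        ((ht.pow _).const_sub _).div_const _
      simp_rw [inv_pow] at h
      convert h using 2
      rw [zero_add, Nat.factorial_succ]
      push_cast
      field_simp
      simp
  | succ a ih =>
    obtain ⟨F, h0, h1, h2⟩ := ih
    refine ⟨fun t => ((a + 1) * F t - t ^ (a + 1) * ((t + q) ^ (a + b + 2))⁻¹) / (a + b + 2),
      by simp [h0], fun t ht => ?_, ?_⟩
    · refine ((((h1 t ht).const_mul _).sub ((hasDerivAt_pow (a + 1) t).mul
        (hd (a + b + 2) ht))).div_const _).congr_deriv ?_
      have : t + q ≠ 0 := by positivity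
      rw [show a + 1 + b + 2 = a + b + 2 + 1 by omega, Nat.add_sub_cancel]
      push_cast
      field_simp
      ring
    · have h3 : Filter.Tendsto (fun t : ℝ => t * (t + q)⁻¹) Filter.atTop (nhds 1) := by
        have := (ht.const_mul q).const_sub 1
        rw [mul_zero, sub_zero] at this
        refine this.congr' ?_
        filter_upwards [Filter.eventually_ge_atTop 0] with t ht
        have : t + q ≠ 0 := by positivity
        field_simp
        ring
      have h := ((h2.const_mul (a + 1 : ℝ)).sub ((h3.pow (a + 1)).mul (ht.pow (b + 1)))).div_const
        (a + b + 2 : ℝ)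
      convert h using 2
      · rw [mul_pow, mul_assoc, ← pow_add, inv_pow]
        ring_nf
      · rw [show a + 1 + b + 1 = a + b + 1 + 1 by omega, Nat.factorial_succ (a + b + 1),
          Nat.factorial_succ a]
        push_cast
        field_simp
        simp
        ring

theorem lintegral_Ioi_pow_div {q : ℝ} (hq : 0 < q) (a b : ℕ) :
    ∫⁻ t in Set.Ioi (0 : ℝ), ENNReal.ofReal (t ^ a / (t + q) ^ (a + b + 2)) =
      ENNReal.ofReal ((q ^ (b + 1))⁻¹ * (a.factorial * b.factorial / (a + b + 1).factorial)) := by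
  obtain ⟨F, h0, h1, h2⟩ := exists_antideriv_pow_div hq a b
  rw [lintegral_Ioi_ofReal_deriv (h1 0 le_rfl).continuousAt.continuousWithinAt
    (fun t ht => h1 t (le_of_lt ht)) (fun t ht => ?_) h2, h0, sub_zero]
  have : (0 : ℝ) < t := ht
  positivity

theorem gramPoly_coeff_eq_transpose {ι κ : Type*} [Fintype ι] [DecidableEq ι] [Fintype κ]
    [DecidableEq κ] (h : Fintype.card ι ≤ Fintype.card κ) (A : Matrix ι κ ℂ) (j : ℕ) :
    (gramPoly A).coeff j = (gramPoly Aᵀ).coeff (j + (Fintype.card κ - Fintype.card ι)) := by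
  rw [gramPoly_transpose _ h, Polynomial.coeff_X_pow_mul]

theorem lintegral_gramPoly_coeff_div_eval {ι κ : Type*} [Fintype ι] [DecidableEq ι] [Fintype κ]
    (h : Fintype.card ι ≤ Fintype.card κ) (a₀ : ι) {t : ℝ} (ht : 0 < t) (j : ℕ) :
    ∫⁻ X, ENNReal.ofReal ((gramPoly (Matrix.of X)).coeff j / (gramPoly (Matrix.of X)).eval t)
        ∂(cGaussRows ι κ) =
      ∫⁻ X, ENNReal.ofReal ((gramPoly (Matrix.of X)).coeff j /
        (t + ∑ j, ‖X a₀ j‖ ^ 2) ^ Fintype.card ι) ∂(cGaussRows ι κ) := by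
  classical
  have hm (k : ℕ) : Measurable fun X : ι → κ → ℂ => (gramPoly (Matrix.of X)).coeff k :=
    measurable_gramPoly_coeff (fun i k => by simp only [of_apply]; fun_prop) k
  have hme : Measurable fun X : ι → κ → ℂ => (gramPoly (Matrix.of X)).eval t := by
    simp_rw [Polynomial.eval_eq_sum_range, gramPoly_natDegree]
    fun_prop
  rw [← lintegral_cGaussPi_prod (fun X => ENNReal.ofReal ((gramPoly (Matrix.of X)).coeff j /
      (gramPoly (Matrix.of X)).eval t)) (by fun_prop),
    ← lintegral_cGaussPi_prod (fun X => ENNReal.ofReal ((gramPoly (Matrix.of X)).coeff j /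
      (t + ∑ j, ‖X a₀ j‖ ^ 2) ^ Fintype.card ι)) (by fun_prop)]
  have hmx : Measurable fun x : ι × κ → ℂ =>
      (gramPoly (Matrix.of fun i j => x (i, j))).coeff j := (hm j).comp (by fun_prop)
  have key := lintegral_mul_inv_prod_gramEig a₀
    (fun x : ι × κ → ℂ => ENNReal.ofReal ((gramPoly (Matrix.of fun i j => x (i, j))).coeff j /
      t ^ Fintype.card ι)) (by fun_prop)
    (fun U x => by
      have hU : (Matrix.of fun i j => ∑ k, (U : Matrix ι ι ℂ) i k * x (k, j)) =
          (U : Matrix ι ι ℂ) * Matrix.of fun i j => x (i, j) := by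
        ext i j
        simp only [mul_apply, of_apply]
      rw [hU, gramPoly_coeff_eq_transpose h, gramPoly_unitary_mul_transpose U,
        ← gramPoly_coeff_eq_transpose h]) (inv_nonneg.2 ht.le)
  have hnn (x : ι × κ → ℂ) : 0 ≤ (gramPoly (Matrix.of fun i j => x (i, j))).coeff j /
      t ^ Fintype.card ι := div_nonneg (gramPoly_coeff_nonneg _ _) (by positivity)
  simp_rw [fun (x : ι × κ → ℂ) (r : ℝ) => (ENNReal.ofReal_mul (q := r) (hnn x)).symm] at key
  convert key using 5 with x x
  · rw [eval_gramPoly, ← div_eq_mul_inv, div_div, ← Finset.card_univ,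
      ← Finset.prod_const, ← Finset.prod_mul_distrib]
    congr 1
    refine Finset.prod_congr rfl fun a _ => ?_
    field_simp
  · rw [← div_eq_mul_inv, div_div, ← mul_pow]
    congr 2
    field_simp

/-- The rational function `∑ λ / (λ + t)` of the squared singular values, expressed through the
coefficients of `gramPoly`. -/
def gramResolvent {ι κ : Type*} [Fintype ι] [DecidableEq ι] [Fintype κ] (A : Matrix ι κ ℂ)
    (t : ℝ) : ℝ :=
  (∑ j ∈ Finset.range (Fintype.card ι + 1),
    ((Fintype.card ι : ℝ) - j) * (gramPoly A).coeff j * t ^ j) / (gramPoly A).eval t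

theorem measurable_gramResolvent {ι κ Ω : Type*} [Fintype ι] [DecidableEq ι] [Fintype κ]
    [MeasurableSpace Ω] {A : Ω → Matrix ι κ ℂ} (hA : ∀ i j, Measurable fun ω => A ω i j) :
    Measurable fun p : ℝ × Ω => gramResolvent (A p.2) p.1 := by
  have hm (k : ℕ) : Measurable fun p : ℝ × Ω => (gramPoly (A p.2)).coeff k :=
    (measurable_gramPoly_coeff hA k).comp measurable_snd
  unfold gramResolvent
  simp_rw [Polynomial.eval_eq_sum_range, gramPoly_natDegree]
  fun_prop

theorem gramResolvent_sub_nonneg {ι κ : Type*} [Fintype ι] [DecidableEq ι] [Fintype κ]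
    (A : Matrix ι κ ℂ) {t : ℝ} (ht : 0 < t) :
    0 ≤ gramResolvent A t - (∑ i, ∑ j, ‖A i j‖ ^ 2) / ((∑ i, ∑ j, ‖A i j‖ ^ 2) + t) := by
  rw [gramResolvent, ← sum_gramEig_div A ht, ← sum_gramEig, sub_nonneg, Finset.sum_div]
  refine Finset.sum_le_sum fun a _ => ?_
  have h := gramEig_nonneg A
  have := Finset.single_le_sum (fun i _ => h i) (Finset.mem_univ a)
  exact div_le_div_of_nonneg_left (h a) (add_pos_of_nonneg_of_pos (h a) ht) (by linarith)

theorem div_add_eq_add_sum (c : ℝ) {q t : ℝ} (h : t + q ≠ 0) (M : ℕ) :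
    c / (q + t) = c * t ^ M / (t + q) ^ (M + 1) +
      ∑ j ∈ Finset.range M, c * q * (t ^ j / (t + q) ^ (j + 2)) := by
  induction M with
  | zero => simp [add_comm]
  | succ M ih =>
    rw [ih, Finset.sum_range_succ]
    field_simp
    ring

theorem lintegral_sub_add_eq {Ω : Type*} [MeasurableSpace Ω] {μ : Measure Ω}
    [IsProbabilityMeasure μ] {G b d s u w : Ω → ℝ} (hb : Measurable b) (hs : Measurable s)
    (hu : Measurable u) (hb0 : ∀ x, 0 ≤ b x) (hb1 : ∀ x, b x ≤ 1) (hs0 : ∀ x, 0 ≤ s x)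
    (hu0 : ∀ x, 0 ≤ u x) (hw0 : ∀ x, 0 ≤ w x) (hG : ∀ x, 0 ≤ G x - b x)
    (hd : ∀ x, 0 ≤ d x - b x) (hdws : ∀ x, d x = w x + s x)
    (h : ∫⁻ x, ENNReal.ofReal (G x) ∂μ = ∫⁻ x, ENNReal.ofReal (u x + w x) ∂μ) :
    ∫⁻ x, ENNReal.ofReal (G x - b x) ∂μ + ∫⁻ x, ENNReal.ofReal (s x) ∂μ =
      ∫⁻ x, ENNReal.ofReal (d x - b x) ∂μ + ∫⁻ x, ENNReal.ofReal (u x) ∂μ := by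
  have hfin : ∫⁻ x, ENNReal.ofReal (b x) ∂μ ≠ ⊤ := by
    refine ne_top_of_le_ne_top ENNReal.one_ne_top ?_
    calc ∫⁻ x, ENNReal.ofReal (b x) ∂μ ≤ ∫⁻ x, 1 ∂μ :=
          lintegral_mono fun x => ENNReal.ofReal_le_one.2 (hb1 x)
      _ = 1 := by simp
  have hcan (f : Ω → ℝ) (hf : ∀ x, 0 ≤ f x - b x) :
      ∫⁻ x, ENNReal.ofReal (f x) ∂μ =
        ∫⁻ x, ENNReal.ofReal (f x - b x) ∂μ + ∫⁻ x, ENNReal.ofReal (b x) ∂μ := by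
    rw [← lintegral_add_right _ (by fun_prop)]
    refine lintegral_congr fun x => ?_
    rw [← ENNReal.ofReal_add (hf x) (hb0 x), sub_add_cancel]
  have h4 : ∫⁻ x, ENNReal.ofReal (G x) ∂μ + ∫⁻ x, ENNReal.ofReal (s x) ∂μ =
      ∫⁻ x, ENNReal.ofReal (d x) ∂μ + ∫⁻ x, ENNReal.ofReal (u x) ∂μ := by
    rw [h, ← lintegral_add_right _ (by fun_prop), ← lintegral_add_right _ (by fun_prop)]
    refine lintegral_congr fun x => ?_
    rw [← ENNReal.ofReal_add (add_nonneg (hu0 x) (hw0 x)) (hs0 x), hdws,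
      ← ENNReal.ofReal_add (add_nonneg (hw0 x) (hs0 x)) (hu0 x)]
    ring_nf
  rw [hcan G hG, hcan d hd] at h4
  refine (ENNReal.add_left_inj hfin).1 ?_
  rw [add_right_comm, h4, add_right_comm]

theorem measurable_gramPoly_of_coeff {ι κ : Type*} [Fintype ι] [DecidableEq ι] [Fintype κ]
    (j : ℕ) : Measurable fun X : ι → κ → ℂ => (gramPoly (Matrix.of X)).coeff j :=
  measurable_gramPoly_coeff (fun i k => by simp only [of_apply]; fun_prop) j

theorem measurable_gramPoly_of_eval {ι κ : Type*} [Fintype ι] [DecidableEq ι] [Fintype κ]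
    (t : ℝ) : Measurable fun X : ι → κ → ℂ => (gramPoly (Matrix.of X)).eval t := by
  have hm (k : ℕ) := measurable_gramPoly_of_coeff (ι := ι) (κ := κ) k
  simp_rw [Polynomial.eval_eq_sum_range, gramPoly_natDegree]
  fun_prop

theorem lintegral_gramResolvent {κ : Type*} [Fintype κ] {M : ℕ}
    (hM : M + 1 ≤ Fintype.card κ) {t : ℝ} (ht : 0 < t) :
    ∫⁻ X, ENNReal.ofReal (gramResolvent (Matrix.of X) t) ∂(cGaussRows (Fin (M + 1)) κ) =
      ∫⁻ X, ENNReal.ofReal (∑ j ∈ Finset.range M, ((M : ℝ) + 1 - j) *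
          (gramPoly (Matrix.of X)).coeff j * (t ^ j /
            (t + ∑ j, ‖X (Fin.last M) j‖ ^ 2) ^ (M + 1)) +
          (∑ i, ∑ j, ‖X i j‖ ^ 2) * t ^ M / (t + ∑ j, ‖X (Fin.last M) j‖ ^ 2) ^ (M + 1))
        ∂(cGaussRows (Fin (M + 1)) κ) := by
  have hm (k : ℕ) := measurable_gramPoly_of_coeff (ι := Fin (M + 1)) (κ := κ) k
  have hme := measurable_gramPoly_of_eval (ι := Fin (M + 1)) (κ := κ) t
  have hj0 {j : ℕ} (hj : j ∈ Finset.range (M + 1)) : 0 ≤ (M : ℝ) + 1 - j := by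
    have : (j : ℝ) < M + 1 := by exact_mod_cast Finset.mem_range.1 hj
    linarith
  have hL (X : Fin (M + 1) → κ → ℂ) : ENNReal.ofReal (gramResolvent (Matrix.of X) t) =
      ∑ j ∈ Finset.range (M + 1), ENNReal.ofReal (((M : ℝ) + 1 - j) * t ^ j) *
        ENNReal.ofReal ((gramPoly (Matrix.of X)).coeff j / (gramPoly (Matrix.of X)).eval t) := by
    have hP := eval_gramPoly_pos (Matrix.of X) ht
    rw [gramResolvent, Fintype.card_fin, Finset.sum_range_succ, sub_self, zero_mul, zero_mul,
      add_zero, Finset.sum_div, ENNReal.ofReal_sum_of_nonneg]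
    · refine Finset.sum_congr rfl fun j hj => ?_
      rw [← ENNReal.ofReal_mul (mul_nonneg (hj0 hj) (by positivity))]
      push_cast
      congr 1
      ring
    · intro j hj
      push_cast
      have := hj0 hj
      have := gramPoly_coeff_nonneg (Matrix.of X) j
      positivity
  have hR (X : Fin (M + 1) → κ → ℂ) : ENNReal.ofReal (∑ j ∈ Finset.range M, ((M : ℝ) + 1 - j) *
          (gramPoly (Matrix.of X)).coeff j * (t ^ j /
            (t + ∑ j, ‖X (Fin.last M) j‖ ^ 2) ^ (M + 1)) +
          (∑ i, ∑ j, ‖X i j‖ ^ 2) * t ^ M / (t + ∑ j, ‖X (Fin.last M) j‖ ^ 2) ^ (M + 1)) =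
      ∑ j ∈ Finset.range (M + 1), ENNReal.ofReal (((M : ℝ) + 1 - j) * t ^ j) *
        ENNReal.ofReal ((gramPoly (Matrix.of X)).coeff j /
          (t + ∑ j, ‖X (Fin.last M) j‖ ^ 2) ^ (Fintype.card (Fin (M + 1)))) := by
    have hq : 0 ≤ ∑ j, ‖X (Fin.last M) j‖ ^ 2 := by positivity
    have hc := gramPoly_coeff_card_sub_one (Matrix.of X) (k := M) (by simp)
    simp only [of_apply] at hc
    rw [← hc]
    have hterm : ∀ j ∈ Finset.range (M + 1), ENNReal.ofReal (((M : ℝ) + 1 - j) * t ^ j) *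
        ENNReal.ofReal ((gramPoly (Matrix.of X)).coeff j /
          (t + ∑ j, ‖X (Fin.last M) j‖ ^ 2) ^ (Fintype.card (Fin (M + 1)))) =
        ENNReal.ofReal (((M : ℝ) + 1 - j) * (gramPoly (Matrix.of X)).coeff j * (t ^ j /
            (t + ∑ j, ‖X (Fin.last M) j‖ ^ 2) ^ (M + 1))) := by
      intro j hj
      rw [← ENNReal.ofReal_mul (mul_nonneg (hj0 hj) (by positivity)), Fintype.card_fin]
      congr 1
      ring
    rw [Finset.sum_congr rfl hterm, ← ENNReal.ofReal_sum_of_nonneg, Finset.sum_range_succ]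
    · congr 2
      ring
    · intro j hj
      have := hj0 hj
      have := gramPoly_coeff_nonneg (Matrix.of X) j
      positivity
  simp_rw [hL, hR]
  rw [lintegral_finsetSum _ fun j _ => by fun_prop, lintegral_finsetSum _ fun j _ => by fun_prop]
  refine Finset.sum_congr rfl fun j _ => ?_
  rw [lintegral_const_mul _ (by fun_prop), lintegral_const_mul _ (by fun_prop),
    lintegral_gramPoly_coeff_div_eval (by simpa using hM) (Fin.last M) ht]

theorem lintegral_gramResolvent_sub {κ : Type*} [Fintype κ] {M : ℕ}
    (hM : M + 1 ≤ Fintype.card κ) {t : ℝ} (ht : 0 < t) :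
    ∫⁻ X, ENNReal.ofReal (gramResolvent (Matrix.of X) t -
        (∑ i, ∑ j, ‖X i j‖ ^ 2) / ((∑ i, ∑ j, ‖X i j‖ ^ 2) + t)) ∂(cGaussRows (Fin (M + 1)) κ) +
      ∫⁻ X, ENNReal.ofReal (∑ j ∈ Finset.range M, (∑ i, ∑ j, ‖X i j‖ ^ 2) *
        (∑ j, ‖X (Fin.last M) j‖ ^ 2) * (t ^ j / (t + ∑ j, ‖X (Fin.last M) j‖ ^ 2) ^ (j + 2)))
          ∂(cGaussRows (Fin (M + 1)) κ) =
    ∫⁻ X, ENNReal.ofReal ((∑ i, ∑ j, ‖X i j‖ ^ 2) / ((∑ j, ‖X (Fin.last M) j‖ ^ 2) + t) -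
        (∑ i, ∑ j, ‖X i j‖ ^ 2) / ((∑ i, ∑ j, ‖X i j‖ ^ 2) + t)) ∂(cGaussRows (Fin (M + 1)) κ) +
      ∫⁻ X, ENNReal.ofReal (∑ j ∈ Finset.range M, ((M : ℝ) + 1 - j) *
        (gramPoly (Matrix.of X)).coeff j * (t ^ j /
          (t + ∑ j, ‖X (Fin.last M) j‖ ^ 2) ^ (M + 1))) ∂(cGaussRows (Fin (M + 1)) κ) := by
  have hm (k : ℕ) := measurable_gramPoly_of_coeff (ι := Fin (M + 1)) (κ := κ) k
  have hj0 {j : ℕ} (hj : j ∈ Finset.range M) : 0 ≤ (M : ℝ) + 1 - j := by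
    have : (j : ℝ) < M := by exact_mod_cast Finset.mem_range.1 hj
    linarith
  refine lintegral_sub_add_eq (w := fun X => (∑ i, ∑ j, ‖X i j‖ ^ 2) * t ^ M /
      (t + ∑ j, ‖X (Fin.last M) j‖ ^ 2) ^ (M + 1)) (by fun_prop) (by fun_prop) (by fun_prop)
    (fun X => by positivity) (fun X => ?_) (fun X => by positivity) (fun X => ?_)
    (fun X => by positivity) (fun X => gramResolvent_sub_nonneg _ ht) (fun X => ?_) (fun X => ?_)
    (lintegral_gramResolvent hM ht)
  · exact div_le_one_of_le₀ (by linarith) (by positivity)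
  · refine Finset.sum_nonneg fun j hj => ?_
    have := hj0 hj
    have := gramPoly_coeff_nonneg (Matrix.of X) j
    positivity
  · exact sub_nonneg.2 (div_le_div_of_nonneg_left (by positivity) (by positivity)
      (by linarith [sum_norm_sq_le X]))
  · exact div_add_eq_add_sum _ (by positivity) M

/-- The unnormalised entropy `c log c - ∑ λ log λ` of the squared singular values `λ`, whose sum
is `c`. -/
def gramEntropy {ι κ : Type*} [Fintype ι] [DecidableEq ι] [Fintype κ] (A : Matrix ι κ ℂ) : ℝ :=
  (∑ i, ∑ j, ‖A i j‖ ^ 2) * Real.log (∑ i, ∑ j, ‖A i j‖ ^ 2) -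
    ∑ a, gramEig A a * Real.log (gramEig A a)

theorem lintegral_Ioi_gramResolvent_sub {ι κ : Type*} [Fintype ι] [DecidableEq ι] [Fintype κ]
    (A : Matrix ι κ ℂ) :
    ∫⁻ t in Set.Ioi (0 : ℝ), ENNReal.ofReal (gramResolvent A t -
        (∑ i, ∑ j, ‖A i j‖ ^ 2) / ((∑ i, ∑ j, ‖A i j‖ ^ 2) + t)) =
      ENNReal.ofReal (gramEntropy A) := by
  have hsum (t : ℝ) (ht : 0 < t) : gramResolvent A t -
      (∑ i, ∑ j, ‖A i j‖ ^ 2) / ((∑ i, ∑ j, ‖A i j‖ ^ 2) + t) =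
      ∑ o : Option ι, o.elim (-∑ i, ∑ j, ‖A i j‖ ^ 2) (gramEig A) /
        (o.elim (∑ i, ∑ j, ‖A i j‖ ^ 2) (gramEig A) + t) := by
    rw [Fintype.sum_option, gramResolvent, ← sum_gramEig_div A ht]
    simp only [Option.elim]
    ring
  have hL : ∫⁻ t in Set.Ioi (0 : ℝ), ENNReal.ofReal (gramResolvent A t -
        (∑ i, ∑ j, ‖A i j‖ ^ 2) / ((∑ i, ∑ j, ‖A i j‖ ^ 2) + t)) =
      ∫⁻ t in Set.Ioi (0 : ℝ), ENNReal.ofReal (∑ o : Option ι,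
        o.elim (-∑ i, ∑ j, ‖A i j‖ ^ 2) (gramEig A) /
          (o.elim (∑ i, ∑ j, ‖A i j‖ ^ 2) (gramEig A) + t)) :=
    setLIntegral_congr_fun measurableSet_Ioi fun t ht => by rw [hsum t ht]
  rw [hL, lintegral_Ioi_sum_div]
  · rw [Fintype.sum_option, gramEntropy]
    simp only [Option.elim]
    congr 1
    ring
  · rw [Fintype.sum_option]
    simp only [Option.elim]
    rw [sum_gramEig, neg_add_cancel]
  · rintro (_ | a) -
    · simp only [Option.elim]
      positivity
    · exact gramEig_nonneg A a
  · rintro (_ | a) - h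
    · simpa using h
    · exact h
  · intro t ht
    rw [← hsum t ht]
    exact gramResolvent_sub_nonneg A ht

theorem lintegral_Ioi_div_sub_div {c q : ℝ} (hq : 0 < q) (hqc : q ≤ c) :
    ∫⁻ t in Set.Ioi (0 : ℝ), ENNReal.ofReal (c / (q + t) - c / (c + t)) =
      ENNReal.ofReal (c * Real.log (c / q)) := by
  have hc := hq.trans_le hqc
  have h := lintegral_Ioi_sum_div Finset.univ ![c, -c] ![q, c] (by simp)
    (by simp [Fin.forall_fin_two, hq.le, hc.le]) (by simp [Fin.forall_fin_two, hq.ne'])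
    (fun t ht => by
      have : c / (c + t) ≤ c / (q + t) :=
        div_le_div_of_nonneg_left hc.le (by positivity) (by linarith)
      simp only [Fin.sum_univ_two, cons_val_zero, cons_val_one, neg_div]
      linarith)
  simp only [Fin.sum_univ_two, cons_val_zero, cons_val_one, neg_div, ← sub_eq_add_neg] at h
  rw [h, Real.log_div hc.ne' hq.ne']
  congr 1
  ring

theorem lintegral_Ioi_sum_pow_div_low {c q : ℝ} (hc : 0 ≤ c) (hq : 0 < q) (M : ℕ) :
    ∫⁻ t in Set.Ioi (0 : ℝ), ENNReal.ofReal (∑ j ∈ Finset.range M,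
        c * q * (t ^ j / (t + q) ^ (j + 2))) =
      ENNReal.ofReal (c * ∑ j ∈ Finset.range M, (1 : ℝ) / (j + 1)) := by
  have hL : ∫⁻ t in Set.Ioi (0 : ℝ), ENNReal.ofReal (∑ j ∈ Finset.range M,
        c * q * (t ^ j / (t + q) ^ (j + 2))) = ∫⁻ t in Set.Ioi (0 : ℝ),
      ∑ j ∈ Finset.range M, ENNReal.ofReal (c * q) *
        ENNReal.ofReal (t ^ j / (t + q) ^ (j + 0 + 2)) := by
    refine setLIntegral_congr_fun measurableSet_Ioi fun t ht => ?_
    have ht : (0 : ℝ) < t := ht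
    rw [ENNReal.ofReal_sum_of_nonneg fun j _ => by positivity]
    refine Finset.sum_congr rfl fun j _ => ?_
    rw [ENNReal.ofReal_mul (by positivity), add_zero]
  rw [hL, lintegral_finsetSum _ fun j _ => by fun_prop, Finset.mul_sum,
    ENNReal.ofReal_sum_of_nonneg fun j _ => by positivity]
  refine Finset.sum_congr rfl fun j _ => ?_
  rw [lintegral_const_mul _ (by fun_prop), lintegral_Ioi_pow_div hq j 0,
    ← ENNReal.ofReal_mul (by positivity), add_zero, Nat.factorial_succ]
  congr 1
  push_cast
  field_simp
  simp

theorem lintegral_Ioi_sum_pow_div_high {q : ℝ} (hq : 0 < q) (M : ℕ) (e : ℕ → ℝ)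
    (he : ∀ j, 0 ≤ e j) :
    ∫⁻ t in Set.Ioi (0 : ℝ), ENNReal.ofReal (∑ j ∈ Finset.range M, ((M : ℝ) + 1 - j) * e j *
        (t ^ j / (t + q) ^ (M + 1))) =
      ∑ j ∈ Finset.range M, ENNReal.ofReal (((M : ℝ) + 1 - j) *
          (j.factorial * (M - 1 - j).factorial / M.factorial)) *
        (ENNReal.ofReal (e j) * ENNReal.ofReal (q ^ (M - j))⁻¹) := by
  have hj0 {j : ℕ} (hj : j ∈ Finset.range M) : 0 ≤ (M : ℝ) + 1 - j := by
    have : (j : ℝ) < M := by exact_mod_cast Finset.mem_range.1 hj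
    linarith
  have hL : ∫⁻ t in Set.Ioi (0 : ℝ), ENNReal.ofReal (∑ j ∈ Finset.range M,
        ((M : ℝ) + 1 - j) * e j * (t ^ j / (t + q) ^ (M + 1))) = ∫⁻ t in Set.Ioi (0 : ℝ),
      ∑ j ∈ Finset.range M, ENNReal.ofReal (((M : ℝ) + 1 - j) * e j) *
        ENNReal.ofReal (t ^ j / (t + q) ^ (j + (M - 1 - j) + 2)) := by
    refine setLIntegral_congr_fun measurableSet_Ioi fun t ht => ?_
    have ht : (0 : ℝ) < t := ht
    rw [ENNReal.ofReal_sum_of_nonneg fun j hj => mul_nonneg (mul_nonneg (hj0 hj) (he j))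
      (by positivity)]
    refine Finset.sum_congr rfl fun j hj => ?_
    have := Finset.mem_range.1 hj
    rw [ENNReal.ofReal_mul (mul_nonneg (hj0 hj) (he j)),
      show j + (M - 1 - j) + 2 = M + 1 by omega]
  rw [hL, lintegral_finsetSum _ fun j _ => by fun_prop]
  refine Finset.sum_congr rfl fun j hj => ?_
  have := Finset.mem_range.1 hj
  rw [lintegral_const_mul _ (by fun_prop), lintegral_Ioi_pow_div hq,
    ← ENNReal.ofReal_mul (mul_nonneg (hj0 hj) (he j)), ← ENNReal.ofReal_mul (he j),
    ← ENNReal.ofReal_mul (mul_nonneg (hj0 hj) (by positivity)),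
    show j + (M - 1 - j) + 1 = M by omega, show M - 1 - j + 1 = M - j by omega]
  congr 1
  ring

theorem lintegral_add_eq_of_Ioi {Ω : Type*} [MeasurableSpace Ω] {μ : Measure Ω} [SFinite μ]
    {F₁ F₂ F₃ F₄ : ℝ → Ω → ℝ} {g₁ g₂ g₃ g₄ : Ω → ENNReal}
    (m₁ : Measurable fun p : ℝ × Ω => F₁ p.1 p.2) (m₂ : Measurable fun p : ℝ × Ω => F₂ p.1 p.2)
    (m₃ : Measurable fun p : ℝ × Ω => F₃ p.1 p.2) (m₄ : Measurable fun p : ℝ × Ω => F₄ p.1 p.2)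
    (h₁ : ∀ᵐ x ∂μ, ∫⁻ t in Set.Ioi (0 : ℝ), ENNReal.ofReal (F₁ t x) = g₁ x)
    (h₂ : ∀ᵐ x ∂μ, ∫⁻ t in Set.Ioi (0 : ℝ), ENNReal.ofReal (F₂ t x) = g₂ x)
    (h₃ : ∀ᵐ x ∂μ, ∫⁻ t in Set.Ioi (0 : ℝ), ENNReal.ofReal (F₃ t x) = g₃ x)
    (h₄ : ∀ᵐ x ∂μ, ∫⁻ t in Set.Ioi (0 : ℝ), ENNReal.ofReal (F₄ t x) = g₄ x)
    (h : ∀ t, 0 < t → ∫⁻ x, ENNReal.ofReal (F₁ t x) ∂μ + ∫⁻ x, ENNReal.ofReal (F₂ t x) ∂μ =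
      ∫⁻ x, ENNReal.ofReal (F₃ t x) ∂μ + ∫⁻ x, ENNReal.ofReal (F₄ t x) ∂μ) :
    ∫⁻ x, g₁ x ∂μ + ∫⁻ x, g₂ x ∂μ = ∫⁻ x, g₃ x ∂μ + ∫⁻ x, g₄ x ∂μ := by
  have hswap {F : ℝ → Ω → ℝ} {g : Ω → ENNReal} (hF : Measurable fun p : ℝ × Ω => F p.1 p.2)
      (h : ∀ᵐ x ∂μ, ∫⁻ t in Set.Ioi (0 : ℝ), ENNReal.ofReal (F t x) = g x) :
      ∫⁻ x, g x ∂μ = ∫⁻ t in Set.Ioi (0 : ℝ), ∫⁻ x, ENNReal.ofReal (F t x) ∂μ := by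
    rw [lintegral_lintegral_swap hF.ennreal_ofReal.aemeasurable]
    exact (lintegral_congr_ae h).symm
  rw [hswap m₁ h₁, hswap m₂ h₂, hswap m₃ h₃, hswap m₄ h₄,
    ← lintegral_add_left m₁.ennreal_ofReal.lintegral_prod_right',
    ← lintegral_add_left m₃.ennreal_ofReal.lintegral_prod_right']
  exact setLIntegral_congr_fun measurableSet_Ioi h

theorem lintegral_add_of_lintegral_Ioi {Ω : Type*} [MeasurableSpace Ω] {μ : Measure Ω} [SFinite μ]
    {F : ℝ → Ω → ℝ} {g : Ω → ENNReal} {c q : Ω → ℝ} {e : ℕ → Ω → ℝ} {M : ℕ}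
    (hF : Measurable fun p : ℝ × Ω => F p.1 p.2) (hc : Measurable c) (hq : Measurable q)
    (he : ∀ j, Measurable (e j)) (he₀ : ∀ j x, 0 ≤ e j x) (hqc : ∀ x, q x ≤ c x)
    (hq₀ : ∀ᵐ x ∂μ, 0 < q x)
    (hg : ∀ x, ∫⁻ t in Set.Ioi (0 : ℝ), ENNReal.ofReal (F t x) = g x)
    (h : ∀ t, 0 < t → ∫⁻ x, ENNReal.ofReal (F t x) ∂μ +
        ∫⁻ x, ENNReal.ofReal (∑ j ∈ Finset.range M,
          c x * q x * (t ^ j / (t + q x) ^ (j + 2))) ∂μ =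
      ∫⁻ x, ENNReal.ofReal (c x / (q x + t) - c x / (c x + t)) ∂μ +
        ∫⁻ x, ENNReal.ofReal (∑ j ∈ Finset.range M, ((M : ℝ) + 1 - j) * e j x *
          (t ^ j / (t + q x) ^ (M + 1))) ∂μ) :
    ∫⁻ x, g x ∂μ +
      ∫⁻ x, ENNReal.ofReal (c x * ∑ j ∈ Finset.range M, (1 : ℝ) / (j + 1)) ∂μ =
    ∫⁻ x, ENNReal.ofReal (c x * Real.log (c x / q x)) ∂μ +
      ∑ j ∈ Finset.range M, ENNReal.ofReal (((M : ℝ) + 1 - j) *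
          (j.factorial * (M - 1 - j).factorial / M.factorial)) *
        ∫⁻ x, ENNReal.ofReal (e j x) * ENNReal.ofReal (q x ^ (M - j))⁻¹ ∂μ := by
  have hsum : ∑ j ∈ Finset.range M, ENNReal.ofReal (((M : ℝ) + 1 - j) *
          (j.factorial * (M - 1 - j).factorial / M.factorial)) *
        ∫⁻ x, ENNReal.ofReal (e j x) * ENNReal.ofReal (q x ^ (M - j))⁻¹ ∂μ =
      ∫⁻ x, ∑ j ∈ Finset.range M, ENNReal.ofReal (((M : ℝ) + 1 - j) *
          (j.factorial * (M - 1 - j).factorial / M.factorial)) *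
        (ENNReal.ofReal (e j x) * ENNReal.ofReal (q x ^ (M - j))⁻¹) ∂μ := by
    rw [lintegral_finsetSum _ fun j _ => by fun_prop]
    exact Finset.sum_congr rfl fun j _ => (lintegral_const_mul _ (by fun_prop)).symm
  rw [hsum]
  exact lintegral_add_eq_of_Ioi hF (by fun_prop) (by fun_prop) (by fun_prop)
    (Filter.Eventually.of_forall hg)
    (hq₀.mono fun x hx => lintegral_Ioi_sum_pow_div_low (hx.le.trans (hqc x)) hx M)
    (hq₀.mono fun x hx => lintegral_Ioi_div_sub_div hx (hqc x))
    (hq₀.mono fun x hx => lintegral_Ioi_sum_pow_div_high hx M (e · x) (he₀ · x)) h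

theorem measurable_gramResolvent_sub {ι κ Ω : Type*} [Fintype ι] [DecidableEq ι] [Fintype κ]
    [MeasurableSpace Ω] {A : Ω → Matrix ι κ ℂ} (hA : ∀ i j, Measurable fun ω => A ω i j) :
    Measurable fun p : ℝ × Ω => gramResolvent (A p.2) p.1 -
      (∑ i, ∑ j, ‖A p.2 i j‖ ^ 2) / ((∑ i, ∑ j, ‖A p.2 i j‖ ^ 2) + p.1) := by
  have h := measurable_gramResolvent hA
  fun_prop


theorem lintegral_gramEntropy_add {κ : Type*} [Fintype κ] {M : ℕ}
    (hM : M + 1 ≤ Fintype.card κ) :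
    ∫⁻ X, ENNReal.ofReal (gramEntropy (Matrix.of X)) ∂(cGaussRows (Fin (M + 1)) κ) +
      ∫⁻ X, ENNReal.ofReal ((∑ i, ∑ j, ‖X i j‖ ^ 2) * ∑ j ∈ Finset.range M, (1 : ℝ) / (j + 1))
          ∂(cGaussRows (Fin (M + 1)) κ) =
    ∫⁻ X, ENNReal.ofReal ((∑ i, ∑ j, ‖X i j‖ ^ 2) *
        Real.log ((∑ i, ∑ j, ‖X i j‖ ^ 2) / ∑ j, ‖X (Fin.last M) j‖ ^ 2))
          ∂(cGaussRows (Fin (M + 1)) κ) +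
      ∑ j ∈ Finset.range M, ENNReal.ofReal (((M : ℝ) + 1 - j) *
          (j.factorial * (M - 1 - j).factorial / M.factorial)) *
        ∫⁻ X, ENNReal.ofReal ((gramPoly (Matrix.of X)).coeff j) *
          ENNReal.ofReal ((∑ j, ‖X (Fin.last M) j‖ ^ 2) ^ (M - j))⁻¹
          ∂(cGaussRows (Fin (M + 1)) κ) := by
  obtain ⟨N, hN⟩ : ∃ N, Fintype.card κ = N + 1 := ⟨Fintype.card κ - 1, by omega⟩
  exact lintegral_add_of_lintegral_Ioi
    (measurable_gramResolvent_sub (A := fun X : Fin (M + 1) → κ → ℂ => Matrix.of X)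
      fun i k => by simp only [of_apply]; fun_prop)
    (by fun_prop) (by fun_prop) measurable_gramPoly_of_coeff
    (fun j X => gramPoly_coeff_nonneg _ j) sum_norm_sq_le (ae_cGaussRows_last_pos hN)
    (fun X => lintegral_Ioi_gramResolvent_sub (Matrix.of X))
    (fun t ht => lintegral_gramResolvent_sub hM ht)

theorem lintegral_rowMoment_mul {N M i : ℕ} (hi : i + 1 ≤ N) :
    ∫⁻ q, ENNReal.ofReal (rowMoment (N + 1) M (i + 2) q) * ENNReal.ofReal (q ^ (i + 1))⁻¹
        ∂(gammaLaw N) =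
      ENNReal.ofReal (M.choose (i + 1) * (N - i) + M.choose (i + 2) * (N + 1)) := by
  have hd : (N.descFactorial (i + 1) : ℝ) * (N - (i + 1)).factorial = N.factorial := by
    exact_mod_cast (mul_comm _ _).trans (Nat.factorial_mul_descFactorial hi)
  have hf : ((N - i).factorial : ℝ) = (N - i) * (N - (i + 1)).factorial := by
    rw [show N - i = N - (i + 1) + 1 by omega, Nat.factorial_succ,
      show N - (i + 1) + 1 = N - i by omega]
    push_cast [show i ≤ N by omega]
    ring
  have hN : (N.factorial : ℝ) ≠ 0 := by positivity
  have hi' : (0 : ℝ) ≤ N - i := sub_nonneg.2 (by exact_mod_cast (by omega : i ≤ N))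
  have hq : ∀ᵐ q ∂(gammaLaw N), ENNReal.ofReal (rowMoment (N + 1) M (i + 2) q) *
      ENNReal.ofReal (q ^ (i + 1))⁻¹ =
      ENNReal.ofReal (N.descFactorial (i + 1) * M.choose (i + 1)) *
          ENNReal.ofReal (q * (q ^ (i + 1))⁻¹) +
        ENNReal.ofReal (N.descFactorial (i + 1) * (M.choose (i + 2) * (N + 1))) *
          ENNReal.ofReal (q ^ (i + 1))⁻¹ := by
    filter_upwards [ae_gammaLaw_pos N] with q hq
    rw [← ENNReal.ofReal_mul (rowMoment_nonneg _ _ _ hq.le), ← ENNReal.ofReal_mul (by positivity),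
      ← ENNReal.ofReal_mul (by positivity), ← ENNReal.ofReal_add (by positivity) (by positivity),
      rowMoment, Nat.add_sub_cancel]
    congr 1
    push_cast
    ring
  rw [lintegral_congr_ae hq, lintegral_add_left (by fun_prop), lintegral_const_mul _ (by fun_prop),
    lintegral_const_mul _ (by fun_prop), lintegral_gammaLaw_of_mul_pow N (N - i),
    lintegral_gammaLaw_of_mul_pow N (N - (i + 1)), ← ENNReal.ofReal_mul (by positivity),
    ← ENNReal.ofReal_mul (by positivity), ← ENNReal.ofReal_add (by positivity) (by positivity), hf]
  · congr 1
    field_simp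
    rw [← hd]
  · intro q hq
    rw [← div_eq_mul_inv, div_eq_iff (by positivity), ← pow_add, Nat.sub_add_cancel hi]
  · intro q hq
    rw [← mul_assoc, ← div_eq_mul_inv, div_eq_iff (by positivity), ← pow_succ, ← pow_add]
    congr 1
    omega

theorem lintegral_gramPoly_coeff_mul_inv_pow {κ : Type*} [Fintype κ] {M N i : ℕ}
    (hN : Fintype.card κ = N + 1) (hM : M ≤ N) (hi : i < M) :
    ∫⁻ X, ENNReal.ofReal ((gramPoly (Matrix.of X)).coeff (M - 1 - i)) *
        ENNReal.ofReal ((∑ j, ‖X (Fin.last M) j‖ ^ 2) ^ (i + 1))⁻¹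
        ∂(cGaussRows (Fin (M + 1)) κ) =
      ENNReal.ofReal (M.choose (i + 1) * (N - i) + M.choose (i + 2) * (N + 1)) := by
  classical
  rw [← lintegral_rowMoment_mul (by omega : i + 1 ≤ N),
    ← lintegral_gramPoly_coeff_mul hN _ (by fun_prop) M (i + 2) (by omega)]
  refine lintegral_congr fun X => ?_
  rw [gramPoly_coeff_eq_transpose (by simp; omega), Fintype.card_fin,
    show M - 1 - i + (Fintype.card κ - (M + 1)) = N + 1 - (i + 2) by omega]

theorem factorial_mul_choose_add {N M i : ℕ} (hi : i < M) :
    ((i : ℝ) + 2) * ((M - 1 - i).factorial * i.factorial / M.factorial) *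
        (M.choose (i + 1) * (N - i) + M.choose (i + 2) * (N + 1)) =
      (M + 1) * (N + 1) * (1 / (i + 1)) - (i + 2) := by
  have h1 : (M.choose (i + 1) : ℝ) * ((i + 1) * i.factorial) * (M - 1 - i).factorial =
      M.factorial := by
    have := Nat.choose_mul_factorial_mul_factorial (Nat.succ_le_of_lt hi)
    rw [Nat.succ_eq_add_one, Nat.factorial_succ, show M - (i + 1) = M - 1 - i by omega] at this
    exact_mod_cast this
  have h2 : (M.choose (i + 2) : ℝ) * (i + 2) = M.choose (i + 1) * (M - (i + 1)) := by
    have := Nat.choose_succ_right_eq M (i + 1)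
    rw [← Nat.cast_add_one, ← Nat.cast_sub (by omega : i + 1 ≤ M)]
    exact_mod_cast this
  have h3 : (0 : ℝ) < M.factorial := by positivity
  have h4 : (i : ℝ) + 1 ≠ 0 := by positivity
  field_simp
  rw [← h1]
  linear_combination ((M - 1 - i).factorial * i.factorial * (i + 1) * (N + 1) : ℝ) * h2

theorem lintegral_gramEntropy {κ : Type*} [Fintype κ] {M : ℕ} (hM : M + 1 ≤ Fintype.card κ) :
    ∫⁻ X, ENNReal.ofReal (gramEntropy (Matrix.of X)) ∂(cGaussRows (Fin (M + 1)) κ) =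
      ENNReal.ofReal ((M + 1) * Fintype.card κ *
        ((∑ k ∈ Finset.Icc (Fintype.card κ + 1) ((M + 1) * Fintype.card κ), (1 : ℝ) / k) -
          M / (2 * Fintype.card κ))) := by
  obtain ⟨N, hN⟩ : ∃ N, Fintype.card κ = N + 1 := ⟨Fintype.card κ - 1, by omega⟩
  obtain ⟨k, hk⟩ : ∃ k, (M + 1) * (N + 1) = k + 1 := ⟨(M + 1) * (N + 1) - 1, by
    have : 0 < (M + 1) * (N + 1) := by positivity
    omega⟩
  have hk' : ((M : ℝ) + 1) * (N + 1) = k + 1 := by exact_mod_cast hk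
  have h := lintegral_gramEntropy_add hM
  have hB : ∫⁻ X, ENNReal.ofReal ((∑ i, ∑ j, ‖X i j‖ ^ 2) *
      ∑ j ∈ Finset.range M, (1 : ℝ) / (j + 1)) ∂(cGaussRows (Fin (M + 1)) κ) =
      ENNReal.ofReal ((k + 1) * ∑ j ∈ Finset.range M, (1 : ℝ) / (j + 1)) := by
    rw [lintegral_cGaussRows_norm_sq (k := k) (by simp [hN, hk])
      (fun c => ENNReal.ofReal (c * ∑ j ∈ Finset.range M, (1 : ℝ) / (j + 1))) (by fun_prop)]
    have hs : (0 : ℝ) ≤ ∑ j ∈ Finset.range M, (1 : ℝ) / (j + 1) := by positivity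
    simp_rw [ENNReal.ofReal_mul' hs]
    rw [lintegral_mul_const _ (by fun_prop),
      lintegral_gammaLaw_of_mul_pow k (k + 1) _ (fun q _ => by ring), Nat.factorial_succ]
    congr 2
    push_cast
    field_simp
  have hsum : ∑ j ∈ Finset.range M, ENNReal.ofReal (((M : ℝ) + 1 - j) *
          (j.factorial * (M - 1 - j).factorial / M.factorial)) *
        ∫⁻ X, ENNReal.ofReal ((gramPoly (Matrix.of X)).coeff j) *
          ENNReal.ofReal ((∑ j, ‖X (Fin.last M) j‖ ^ 2) ^ (M - j))⁻¹
          ∂(cGaussRows (Fin (M + 1)) κ) =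
      ENNReal.ofReal (∑ i ∈ Finset.range M, ((k + 1) * (1 / ((i : ℝ) + 1)) - (i + 2))) := by
    have hi {i : ℕ} (hi : i ∈ Finset.range M) : (0 : ℝ) ≤ N - i :=
      sub_nonneg.2 (by have := Finset.mem_range.1 hi; exact_mod_cast (by omega : i ≤ N))
    rw [← Finset.sum_range_reflect, ENNReal.ofReal_sum_of_nonneg]
    · refine Finset.sum_congr rfl fun i hiM => ?_
      have := hi hiM
      have hiM := Finset.mem_range.1 hiM
      rw [show M - (M - 1 - i) = i + 1 by omega, show M - 1 - (M - 1 - i) = i by omega,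
        lintegral_gramPoly_coeff_mul_inv_pow hN (by omega) hiM,
        ← ENNReal.ofReal_mul' (by positivity), ← hk', ← factorial_mul_choose_add hiM,
        show M - 1 - i = M - (i + 1) by omega, Nat.cast_sub hiM]
      congr 3
      push_cast
      ring
    · intro i hiM
      have := hi hiM
      rw [← hk', ← factorial_mul_choose_add (Finset.mem_range.1 hiM)]
      positivity
  have hnn : 0 ≤ ∑ i ∈ Finset.range M, ((k + 1) * (1 / ((i : ℝ) + 1)) - (i + 2)) := by
    refine Finset.sum_nonneg fun i hiM => ?_
    have hiM := Finset.mem_range.1 hiM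
    have : (0 : ℝ) ≤ N - i := sub_nonneg.2 (by exact_mod_cast (by omega : i ≤ N))
    rw [← hk', ← factorial_mul_choose_add hiM]
    positivity
  rw [hB, lintegral_mul_log_div hN hk, hsum, ← ENNReal.ofReal_add (by positivity) hnn] at h
  refine (ENNReal.eq_sub_of_add_eq ENNReal.ofReal_ne_top h).trans ?_
  rw [← ENNReal.ofReal_sub _ (by positivity), hN, hk]
  congr 1
  have hg : ∑ i ∈ Finset.range M, ((i : ℝ) + 2) = M * (M + 1) / 2 + M := by
    clear * -
    induction M with
    | zero => simp
    | succ M ih =>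
      rw [Finset.sum_range_succ, ih]
      push_cast
      ring
  rw [Finset.sum_sub_distrib, ← Finset.mul_sum, hg]
  push_cast
  rw [hk', mul_sub, ← hk']
  field_simp
  ring

theorem sum_comp_gramEig_smul {ι κ : Type*} [Fintype ι] [DecidableEq ι] [Fintype κ] (r : ℝ)
    (A : Matrix ι κ ℂ) (f : ℝ → ℝ) :
    ∑ a, f (gramEig (r • A) a) = ∑ a, f (r ^ 2 * gramEig A a) := by
  have hA := isHermitian_mul_conjTranspose_self A
  have h1 : (r • A) * (r • A)ᴴ = cfc (fun x : ℝ => r ^ 2 * x) (A * Aᴴ) := by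
    rw [cfc_const_mul_id (r ^ 2) (A * Aᴴ) hA.isSelfAdjoint, conjTranspose_smul, star_trivial,
      Matrix.smul_mul, Matrix.mul_smul, smul_smul, pow_two]
  have h2 := (charpoly_mul_conjTranspose (r • A)).symm.trans
    ((congrArg charpoly h1).trans (hA.charpoly_cfc_eq _))
  have hroots (g : ι → ℝ) : (∏ a, (Polynomial.X - Polynomial.C (g a : ℂ))).roots =
      Finset.univ.val.map fun a => (g a : ℂ) := by
    simp [Polynomial.roots_prod, Finset.prod_ne_zero_iff, Polynomial.X_sub_C_ne_zero]
  have h3 := (hroots _).symm.trans ((congrArg Polynomial.roots h2).trans (hroots _))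
  have h4 := congrArg (fun s => (s.map fun z : ℂ => f z.re).sum) h3
  simp only [Multiset.map_map, Function.comp_def, Complex.ofReal_re] at h4
  exact h4

theorem gramEntropy_smul {ι κ : Type*} [Fintype ι] [DecidableEq ι] [Fintype κ] {r : ℝ}
    (hr : r ≠ 0) (A : Matrix ι κ ℂ) : gramEntropy (r • A) = r ^ 2 * gramEntropy A := by
  have hlog (x : ℝ) : r ^ 2 * x * Real.log (r ^ 2 * x) =
      r ^ 2 * (x * Real.log x) + Real.log (r ^ 2) * r ^ 2 * x := by
    rcases eq_or_ne x 0 with rfl | hx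
    · simp
    · rw [Real.log_mul (by positivity) hx]
      ring
  rw [gramEntropy, sum_comp_gramEig_smul r A fun x => x * Real.log x, ← sum_gramEig,
    sum_comp_gramEig_smul r A fun x => x, ← Finset.mul_sum, gramEntropy, ← sum_gramEig, hlog]
  simp_rw [hlog]
  rw [Finset.sum_add_distrib, ← Finset.mul_sum, ← Finset.mul_sum]
  ring

theorem measurable_gramEntropy {ι κ Ω : Type*} [Fintype ι] [DecidableEq ι] [Fintype κ]
    [MeasurableSpace Ω] {A : Ω → Matrix ι κ ℂ} (hA : ∀ i j, Measurable fun ω => A ω i j) :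
    Measurable fun ω => ENNReal.ofReal (gramEntropy (A ω)) := by
  simp_rw [← lintegral_Ioi_gramResolvent_sub]
  exact (measurable_gramResolvent_sub hA).ennreal_ofReal.lintegral_prod_left'

theorem measurable_coeffMatrix (m n : ℕ) (i : Fin m) (j : Fin n) :
    Measurable fun v : TensorSp m n => coeffMatrix v i j :=
  (by simp only [coeffMatrix, of_apply]; fun_prop :
    Continuous fun v : TensorSp m n => coeffMatrix v i j).measurable

theorem sum_norm_sq_coeffMatrix {m n : ℕ} (v : TensorSp m n) :
    ∑ i, ∑ j, ‖coeffMatrix v i j‖ ^ 2 = ‖v‖ ^ 2 := by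
  rw [EuclideanSpace.norm_sq_eq, Fintype.sum_prod_type]
  rfl

theorem entEntropy_eq_gramEntropy {m n : ℕ} (v : Metric.sphere (0 : TensorSp m n) 1) :
    entEntropy (v : TensorSp m n) = gramEntropy (coeffMatrix (v : TensorSp m n)) := by
  rw [gramEntropy, sum_norm_sq_coeffMatrix, norm_eq_of_mem_sphere, one_pow, Real.log_one, mul_zero,
    zero_sub]
  rfl

theorem entEntropy_nonneg {m n : ℕ} (v : Metric.sphere (0 : TensorSp m n) 1) :
    0 ≤ entEntropy (v : TensorSp m n) := by
  rw [entEntropy, neg_nonneg]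
  have hs : ∑ a, gramEig (coeffMatrix (v : TensorSp m n)) a = 1 := by
    rw [sum_gramEig, sum_norm_sq_coeffMatrix, norm_eq_of_mem_sphere, one_pow]
  have h := gramEig_nonneg (coeffMatrix (v : TensorSp m n))
  have h1 (a : Fin m) : gramEig (coeffMatrix (v : TensorSp m n)) a ≤ 1 :=
    (Finset.single_le_sum (fun i _ => h i) (Finset.mem_univ a)).trans_eq hs
  exact Finset.sum_nonpos fun a _ => Real.mul_log_nonpos (h a) (h1 a)

theorem integral_entEntropy (m n : ℕ) :
    ∫ v, entEntropy (v : TensorSp m n) ∂(sphereUniform m n) =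
      (∫⁻ v, ENNReal.ofReal (gramEntropy (coeffMatrix (v : TensorSp m n)))
        ∂(sphereUniform m n)).toReal := by
  have hm : Measurable fun v : Metric.sphere (0 : TensorSp m n) 1 =>
      ENNReal.ofReal (gramEntropy (coeffMatrix (v : TensorSp m n))) :=
    (measurable_gramEntropy (measurable_coeffMatrix m n)).comp measurable_subtype_coe
  rw [← integral_toReal hm.aemeasurable (Filter.Eventually.of_forall fun v =>
    ENNReal.ofReal_lt_top)]
  refine integral_congr_ae (Filter.Eventually.of_forall fun v => ?_)
  simp only
  rw [← entEntropy_eq_gramEntropy, ENNReal.toReal_ofReal (entEntropy_nonneg v)]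

theorem div_le_sum_Icc_one_div {M n : ℕ} (h : M ≤ n) :
    (M : ℝ) / (2 * n) ≤ ∑ k ∈ Finset.Icc (n + 1) ((M + 1) * n), (1 : ℝ) / k := by
  rcases Nat.eq_zero_or_pos M with rfl | hM
  · simp
  have hn : (0 : ℝ) < n := by exact_mod_cast hM.trans_le h
  calc (M : ℝ) / (2 * n) ≤ n / (2 * n) := by gcongr
    _ = ∑ k ∈ Finset.Icc (n + 1) (2 * n), (1 : ℝ) / (2 * n) := by
      rw [Finset.sum_const, Nat.card_Icc, show 2 * n + 1 - (n + 1) = n by omega, nsmul_eq_mul]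
      ring
    _ ≤ ∑ k ∈ Finset.Icc (n + 1) (2 * n), (1 : ℝ) / k := by
      refine Finset.sum_le_sum fun k hk => ?_
      obtain ⟨h1, h2⟩ := Finset.mem_Icc.1 hk
      have h0 : (0 : ℝ) < k := by exact_mod_cast (by omega : 0 < k)
      exact one_div_le_one_div_of_le h0 (by exact_mod_cast h2)
    _ ≤ ∑ k ∈ Finset.Icc (n + 1) ((M + 1) * n), (1 : ℝ) / k :=
      Finset.sum_le_sum_of_subset_of_nonneg
        (Finset.Icc_subset_Icc_right (Nat.mul_le_mul_right n (by omega)))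
        fun k _ _ => by positivity

/-- For integers `1 ≤ m ≤ n`, the expected value of the
entanglement entropy over all pure states in `ℂ^m ⊗ ℂ^n`, with respect to the
uniform probability measure on the unit sphere, equals
`∑_{k=n+1}^{mn} 1/k − (m−1)/(2n)`. -/
theorem average_entanglement_entropy (m n : ℕ) (hm : 1 ≤ m) (hmn : m ≤ n) :
    (∫ v, entEntropy (v : TensorSp m n) ∂(sphereUniform m n)) =
      (∑ k ∈ Finset.Icc (n + 1) (m * n), (1 : ℝ) / k) - ((m : ℝ) - 1) / (2 * n) := by
  obtain ⟨M, rfl⟩ : ∃ M, m = M + 1 := ⟨m - 1, by omega⟩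
  have hpos : 0 < (M + 1) * n := Nat.mul_pos hm (by omega)
  have hpos' : (0 : ℝ) < ((M + 1 : ℕ) : ℝ) * n := by exact_mod_cast hpos
  have h := lintegral_sphereUniform (m := M + 1) (n := n) (k := (M + 1) * n - 1) (by omega)
    (fun v => ENNReal.ofReal (gramEntropy (coeffMatrix v)))
    (measurable_gramEntropy (measurable_coeffMatrix _ _)) fun r hr v => by
      rw [← ENNReal.ofReal_mul (by positivity), ← gramEntropy_smul hr.ne']
      rfl
  have hX : Measurable fun X : Fin (M + 1) → Fin n → ℂ =>
      ENNReal.ofReal (gramEntropy (Matrix.of X)) :=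
    measurable_gramEntropy fun i j => by simp only [of_apply]; fun_prop
  have h2 := (lintegral_cGaussPi_prod _ hX).symm.trans h
  rw [lintegral_gramEntropy (by simpa using hmn), Fintype.card_fin] at h2
  have h3 := congrArg ENNReal.toReal h2
  have hv := div_le_sum_Icc_one_div (Nat.le_of_succ_le hmn)
  rw [ENNReal.toReal_mul, ENNReal.toReal_ofReal hpos'.le, ← integral_entEntropy,
    ENNReal.toReal_ofReal (mul_nonneg (by positivity) (sub_nonneg.2 hv))] at h3
  refine mul_left_cancel₀ hpos'.ne' (h3.symm.trans ?_)
  push_cast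
  ring
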